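/- Let m ≥ 2 be an integer with 6 ∤ m and set r := ⌊(m−1)/6⌋. For any cyclic urn process (R_n)_{n≥0} with m types started with one ball of type 0, there exist complex-valued random variables Ξ_1, …, Ξ_r on the same probability space such that, as n → ∞, the random vectors (1/√n)·(R_n − E[R_n] − Σ_{k=1}^r 2·Re(n^{ω^k} Ξ_k v_k)) converge in distribution to the centered Gaussian distribution 𝒩(0, Σ^{(m)}) on ℝ^m, where Σ^{(m)} := Σ_{k=1}^{m−1} (1/|2λ_k − 1|) v_k v_k*. Moreover Σ^{(m)} is a real symmetric positive semidefinite matrix of rank m − 1. -/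

import Mathlib

open MeasureTheory ProbabilityTheory Filter Complex Finset Topology

noncomputable section

/-- `ω = exp(2πi/m)`, the `m`-th elementary root of unity. -/
def cw (m : ℕ) : ℂ := Complex.exp (2 * Real.pi * Complex.I / m)

/-- `λ_k = cos(2πk/m)`. -/
def lam (m k : ℕ) : ℝ := Real.cos (2 * Real.pi * k / m)

/-- `μ_k = sin(2πk/m)`. -/
def muim (m k : ℕ) : ℝ := Real.sin (2 * Real.pi * k / m)

/-- the eigenvector `v_k = (1/m)(1, ω^{-k}, …, ω^{-(m-1)k})`. -/
def vvec (m k : ℕ) : Fin m → ℂ :=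
  fun t => (m : ℂ)⁻¹ * cw m ^ (-((k * (t : ℕ) : ℕ) : ℤ))

/-- the dual coefficient `u_k(w) = ∑_t ω^{kt} w_t`. -/
def ucoef (m k : ℕ) (w : Fin m → ℝ) : ℂ :=
  ∑ t : Fin m, cw m ^ (k * (t : ℕ)) * (w t : ℂ)

/-- the replacement matrix `A` of the cyclic urn. -/
def repA (m : ℕ) : Matrix (Fin m) (Fin m) ℝ :=
  Matrix.of fun i j => if (j : ℕ) = ((i : ℕ) + 1) % m then 1 else 0

/-- the filtration `𝓕_n = σ(R_0, …, R_n)`. -/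
def urnFilt {Ω : Type*} [MeasurableSpace Ω] (m : ℕ) (R : ℕ → Ω → Fin m → ℝ) (n : ℕ) :
    MeasurableSpace Ω :=
  ⨆ i ∈ Finset.range (n + 1), MeasurableSpace.comap (R i) inferInstance

/-- A cyclic urn process with `m` types started with one ball of type `j0`. -/
structure IsCyclicUrn {Ω : Type*} [MeasurableSpace Ω] (μ : Measure Ω) (m : ℕ) (j0 : Fin m)
    (R : ℕ → Ω → Fin m → ℝ) : Prop where
  isProb : IsProbabilityMeasure μ
  meas : ∀ n, Measurable (R n)
  natVal : ∀ n ω i, ∃ z : ℕ, R n ω i = z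
  init : ∀ ω, R 0 ω = fun i => if i = j0 then 1 else 0
  step : ∀ n, ∀ j : Fin m,
    μ[Set.indicator {ω | R (n + 1) ω =
        fun i => R n ω i + if (i : ℕ) = ((j : ℕ) + 1) % m then 1 else 0}
      (fun _ => (1 : ℝ)) | urnFilt m R n]
      =ᵐ[μ] fun ω => R n ω j / (n + 1)

/-- componentwise expectation `E[X]` of a random vector. -/
def expVec {Ω : Type*} [MeasurableSpace Ω] (μ : Measure Ω) {m : ℕ}
    (X : Ω → Fin m → ℝ) : Fin m → ℝ := fun i => ∫ ω, X ω i ∂μ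

/-- the martingale `M_{k,n} = (Γ(n+1)/Γ(n+1+ω^k)) u_k(R_n - E[R_n])`, with `M_{k,0} = 0`. -/
def Mart {Ω : Type*} [MeasurableSpace Ω] (μ : Measure Ω) (m k : ℕ)
    (R : ℕ → Ω → Fin m → ℝ) (n : ℕ) (ω : Ω) : ℂ :=
  if n = 0 then 0
  else (Complex.Gamma ((n : ℂ) + 1) / Complex.Gamma ((n : ℂ) + 1 + cw m ^ k)) *
    ucoef m k (fun t => R n ω t - expVec μ (R n) t)

/-- `ν` is the centered Gaussian distribution `𝒩(0, S)` on `ℝ^d` (Cramér–Wold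
characterization: every linear functional is one-dimensional centered Gaussian). -/
def IsCenteredGaussian {d : ℕ} (ν : Measure (Fin d → ℝ)) (S : Matrix (Fin d) (Fin d) ℝ) : Prop :=
  IsProbabilityMeasure ν ∧
  ∀ l : Fin d → ℝ,
    ν.map (fun x => ∑ i, l i * x i) =
      gaussianReal 0 (Real.toNNReal (∑ i, ∑ j, l i * S i j * l j))

/-- convergence in distribution of the random vectors `X_n` to the law `ν`. -/
def TendstoInDist {Ω : Type*} [MeasurableSpace Ω] (μ : Measure Ω) {d : ℕ}
    (X : ℕ → Ω → Fin d → ℝ) (ν : Measure (Fin d → ℝ)) : Prop :=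
  ∀ f : BoundedContinuousFunction (Fin d → ℝ) ℝ,
    Tendsto (fun n => ∫ ω, f (X n ω) ∂μ) atTop (𝓝 (∫ x, f x ∂ν))


/-- the complex matrix `Σ^{(m)} = ∑_{k=1}^{m-1} (1/|2λ_k-1|) v_k v_k^*`. -/
def cSigmaA (m : ℕ) : Matrix (Fin m) (Fin m) ℂ :=
  Matrix.of fun i j => ∑ k ∈ Finset.Icc 1 (m - 1),
    ((|2 * lam m k - 1|⁻¹ : ℝ) : ℂ) * (vvec m k i * star (vvec m k j))

/-- the real matrix `Σ^{(m)}` (real part of `cSigmaA`). -/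
def rSigmaA (m : ℕ) : Matrix (Fin m) (Fin m) ℝ :=
  Matrix.of fun i j => (cSigmaA m i j).re

section UrnBasics

variable {Ω : Type*} [MeasurableSpace Ω] {μ : Measure Ω} {m : ℕ} {j0 : Fin m}
  {R : ℕ → Ω → Fin m → ℝ}

lemma comap_le_urnFilt {n i : ℕ} (hi : i ≤ n) :
    MeasurableSpace.comap (R i) inferInstance ≤ urnFilt m R n := by
  unfold urnFilt
  exact le_iSup₂_of_le (f := fun i (_ : i ∈ Finset.range (n + 1)) =>
    MeasurableSpace.comap (R i) inferInstance) i (by simp; omega) le_rfl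

lemma urnFilt_mono {n k : ℕ} (h : n ≤ k) : urnFilt m R n ≤ urnFilt m R k := by
  rw [urnFilt]
  refine iSup₂_le fun i hi => comap_le_urnFilt ?_
  simp at hi; omega

lemma measurable_urnFilt {n i : ℕ} (hi : i ≤ n) : Measurable[urnFilt m R n] (R i) :=
  measurable_iff_comap_le.2 (comap_le_urnFilt hi)

/-- The event that the `n`-th drawn ball has type `j`. -/
def drawSet (m : ℕ) (R : ℕ → Ω → Fin m → ℝ) (n : ℕ) (j : Fin m) : Set Ω :=
  {ω | R (n + 1) ω = fun i => R n ω i + if (i : ℕ) = ((j : ℕ) + 1) % m then 1 else 0}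

namespace IsCyclicUrn

lemma urnFilt_le (hR : IsCyclicUrn μ m j0 R) (n : ℕ) : urnFilt m R n ≤ ‹MeasurableSpace Ω› := by
  rw [urnFilt]
  exact iSup₂_le fun i _ => measurable_iff_comap_le.1 (hR.meas i)

lemma nonneg (hR : IsCyclicUrn μ m j0 R) (n : ℕ) (ω : Ω) (i : Fin m) : 0 ≤ R n ω i := by
  obtain ⟨z, hz⟩ := hR.natVal n ω i
  rw [hz]; positivity

lemma measurableSet_drawSet (hR : IsCyclicUrn μ m j0 R) (n : ℕ) (j : Fin m) :
    MeasurableSet (drawSet m R n j) := by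
  refine measurableSet_eq_fun (hR.meas _) ?_
  refine measurable_pi_lambda _ fun i => ?_
  exact ((measurable_pi_apply i).comp (hR.meas n)).add_const _

lemma drawSet_disjoint (hm : 2 ≤ m) (n : ℕ) {j k : Fin m} (hjk : j ≠ k) :
    Disjoint (drawSet m R n j) (drawSet m R n k) := by
  rw [Set.disjoint_left]
  intro ω h1 h2
  simp only [drawSet, Set.mem_ofPred_eq] at h1 h2
  have h3 := congrFun (h1.symm.trans h2) ⟨((j : ℕ) + 1) % m, Nat.mod_lt _ (zero_lt_two.trans_le hm)⟩
  simp only [if_true, add_right_inj] at h3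
  have h4 : ((j : ℕ) + 1) % m = ((k : ℕ) + 1) % m := by
    by_contra h; simp [h] at h3
  apply hjk
  have hj := j.2
  have hk := k.2
  ext
  have : ((j : ℕ) + 1) ≡ ((k : ℕ) + 1) [MOD m] := h4
  have := Nat.ModEq.add_right_cancel' 1 this
  rw [Nat.ModEq, Nat.mod_eq_of_lt hj, Nat.mod_eq_of_lt hk] at this
  exact this

lemma step_drawSet (hR : IsCyclicUrn μ m j0 R) (n : ℕ) (j : Fin m) :
    μ[(drawSet m R n j).indicator (fun _ => (1 : ℝ)) | urnFilt m R n]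
      =ᵐ[μ] fun ω => R n ω j / (n + 1) := hR.step n j

lemma integrable_proportion (hR : IsCyclicUrn μ m j0 R) (n : ℕ) (j : Fin m) :
    Integrable (fun ω => R n ω j / (n + 1)) μ :=
  (integrable_congr (hR.step_drawSet n j)).1 integrable_condExp

lemma integral_proportion (hR : IsCyclicUrn μ m j0 R) (n : ℕ) (j : Fin m) :
    ∫ ω, R n ω j / (n + 1) ∂μ = μ.real (drawSet m R n j) := by
  have := hR.isProb
  rw [← integral_congr_ae (hR.step_drawSet n j), integral_condExp (hR.urnFilt_le n),
    integral_indicator_const _ (hR.measurableSet_drawSet n j)]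
  simp

lemma sum_drawSet (hm : 2 ≤ m) {n : ℕ} {j : Fin m} {ω : Ω}
    (h : ω ∈ drawSet m R n j) (f : Fin m → ℂ) :
    ∑ i, f i * R (n + 1) ω i =
      ∑ i, f i * R n ω i +
        f ⟨((j : ℕ) + 1) % m, Nat.mod_lt _ (zero_lt_two.trans_le hm)⟩ := by
  simp only [drawSet, Set.mem_ofPred_eq] at h
  rw [h]
  simp only [Complex.ofReal_add, mul_add, Finset.sum_add_distrib, add_right_inj]
  rw [Finset.sum_eq_single ⟨((j : ℕ) + 1) % m, Nat.mod_lt _ (zero_lt_two.trans_le hm)⟩]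
  · simp
  · intro b _ hb
    have : ¬ ((b : ℕ) = ((j : ℕ) + 1) % m) := fun h => hb (Fin.ext h)
    simp [this]
  · simp

lemma ae_exists_drawSet_of_sum (hm : 2 ≤ m) (hR : IsCyclicUrn μ m j0 R) (n : ℕ)
    (h : ∀ᵐ ω ∂μ, ∑ i, R n ω i = n + 1) : ∀ᵐ ω ∂μ, ∃ j, ω ∈ drawSet m R n j := by
  have := hR.isProb
  have h1 : μ.real (⋃ j, drawSet m R n j) = 1 := by
    rw [measureReal_iUnion_fintype (fun i j hij => drawSet_disjoint hm n hij)
      (hR.measurableSet_drawSet n)]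
    simp_rw [← hR.integral_proportion]
    rw [← integral_finsetSum _ (fun j _ => hR.integrable_proportion n j)]
    have : (fun ω => ∑ j, R n ω j / ((n : ℝ) + 1)) =ᵐ[μ] fun _ => 1 := by
      filter_upwards [h] with ω hω
      rw [← Finset.sum_div, hω]
      field_simp
    rw [integral_congr_ae this]; simp
  have h2 : μ (⋃ j, drawSet m R n j) = 1 := by
    rw [measureReal_def, ENNReal.toReal_eq_one_iff] at h1; exact h1
  have h3 := (prob_compl_eq_zero_iff (MeasurableSet.iUnion (hR.measurableSet_drawSet n))).2 h2
  rw [ae_iff]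
  convert h3 using 2
  ext; simp

lemma ae_sum (hm : 2 ≤ m) (hR : IsCyclicUrn μ m j0 R) (n : ℕ) :
    ∀ᵐ ω ∂μ, ∑ i, R n ω i = n + 1 := by
  induction n with
  | zero => exact ae_of_all _ fun ω => by simp [hR.init]
  | succ n ih =>
    filter_upwards [ih, hR.ae_exists_drawSet_of_sum hm n ih] with ω h1 ⟨j, hj⟩
    have := sum_drawSet hm hj (fun _ => 1)
    simp only [one_mul] at this
    rw [← Complex.ofReal_sum, ← Complex.ofReal_sum, h1] at this
    push_cast
    exact_mod_cast this

lemma ae_exists_drawSet (hm : 2 ≤ m) (hR : IsCyclicUrn μ m j0 R) (n : ℕ) :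
    ∀ᵐ ω ∂μ, ∃ j, ω ∈ drawSet m R n j :=
  hR.ae_exists_drawSet_of_sum hm n (hR.ae_sum hm n)

/-- One-step averaging: an integrand whose value on each draw is known at time `n` may be replaced
by its conditional mean. -/
lemma integral_step (hm : 2 ≤ m) (hR : IsCyclicUrn μ m j0 R) (n : ℕ) (G : Fin m → Ω → ℂ)
    (hG : ∀ j, StronglyMeasurable[urnFilt m R n] (G j)) (hGi : ∀ j, Integrable (G j) μ)
    (T : Ω → ℂ) (hT : ∀ j, ∀ ω ∈ drawSet m R n j, T ω = G j ω) :
    ∫ ω, T ω ∂μ = ∫ ω, ∑ j, ((R n ω j / (n + 1) : ℝ) : ℂ) * G j ω ∂μ := by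
  have := hR.isProb
  let I : Fin m → Ω → ℝ := fun j => (drawSet m R n j).indicator (fun _ => (1 : ℝ))
  have hI : ∀ j, Integrable (I j) μ := fun j =>
    (integrable_const 1).indicator (hR.measurableSet_drawSet n j)
  have hIG : ∀ j, Integrable (I j • G j) μ := by
    intro j
    have : I j • G j = (drawSet m R n j).indicator (G j) := by
      ext ω
      by_cases h : ω ∈ drawSet m R n j <;> simp [I, h]
    rw [this]
    exact (hGi j).indicator (hR.measurableSet_drawSet n j)
  have key : ∀ j, (fun ω => ((R n ω j / (n + 1) : ℝ) : ℂ) * G j ω) =ᵐ[μ]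
      μ[I j • G j | urnFilt m R n] := by
    intro j
    filter_upwards [condExp_smul_of_aestronglyMeasurable_right (hI j) (hIG j)
      (hG j).aestronglyMeasurable, hR.step_drawSet n j] with ω h1 h2
    rw [h1, Pi.smul_apply', h2]
    simp
  have hT' : T =ᵐ[μ] fun ω => ∑ j, (I j • G j) ω := by
    filter_upwards [hR.ae_exists_drawSet hm n] with ω ⟨j, hj⟩
    rw [Finset.sum_eq_single j]
    · simp [I, hj, hT j ω hj]
    · intro k _ hk
      have : ω ∉ drawSet m R n k := fun h =>
        Set.disjoint_left.1 (drawSet_disjoint hm n hk) h hj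
      simp [I, this]
    · simp
  rw [integral_congr_ae hT', integral_finsetSum _ (fun j _ => hIG j),
    integral_finsetSum _ (fun j _ => (integrable_congr (key j)).2 integrable_condExp)]
  refine Finset.sum_congr rfl fun j _ => ?_
  rw [integral_congr_ae (key j), integral_condExp (hR.urnFilt_le n)]

end IsCyclicUrn

end UrnBasics

section Fourier

lemma isPrimitiveRoot_cw {m : ℕ} (hm : m ≠ 0) : IsPrimitiveRoot (cw m) m :=
  Complex.isPrimitiveRoot_exp m hm

lemma norm_cw (m : ℕ) : ‖cw m‖ = 1 := by
  have : cw m = Complex.exp ((2 * Real.pi / m : ℝ) * Complex.I) := by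
    rw [cw]; congr 1; push_cast; ring
  rw [this, Complex.norm_exp_ofReal_mul_I]

lemma norm_cw_pow (m k : ℕ) : ‖cw m ^ k‖ = 1 := by rw [norm_pow, norm_cw, one_pow]

lemma cw_ne_zero (m : ℕ) : cw m ≠ 0 := by
  rw [← norm_ne_zero_iff, norm_cw]; exact one_ne_zero

lemma conj_cw_pow (m k : ℕ) : (starRingEnd ℂ) (cw m ^ k) = (cw m ^ k)⁻¹ :=
  (Complex.inv_eq_conj (norm_cw_pow m k)).symm

lemma cw_pow_re (m k : ℕ) : (cw m ^ k).re = lam m k := by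
  rw [cw, ← Complex.exp_nat_mul]
  have : (k : ℂ) * (2 * Real.pi * Complex.I / m) = ((2 * Real.pi * k / m : ℝ) : ℂ) * Complex.I := by
    push_cast; ring
  rw [this, Complex.exp_ofReal_mul_I_re, lam]

lemma cw_pow_self {m : ℕ} (hm : m ≠ 0) : cw m ^ m = 1 := (isPrimitiveRoot_cw hm).pow_eq_one

lemma cw_pow_mul_mod {m : ℕ} (hm : m ≠ 0) (k j : ℕ) : cw m ^ (k * (j % m)) = cw m ^ (k * j) := by
  conv_rhs => rw [← Nat.div_add_mod j m]
  rw [mul_add, pow_add, mul_left_comm, pow_mul _ m, cw_pow_self hm, one_pow, one_mul]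

lemma cw_pow_sub {m k : ℕ} (hm : m ≠ 0) (hk : k ≤ m) :
    cw m ^ (m - k) = (starRingEnd ℂ) (cw m ^ k) := by
  rw [conj_cw_pow]
  exact eq_inv_of_mul_eq_one_left (by rw [← pow_add, Nat.sub_add_cancel hk, cw_pow_self hm])

lemma cw_pow_eq_iff {m k l : ℕ} (hk : k < m) (hl : l < m) : cw m ^ k = cw m ^ l ↔ k = l :=
  ⟨fun h => (isPrimitiveRoot_cw (by omega)).pow_inj hk hl h, fun h => by rw [h]⟩

/-- Orthogonality of the characters of `ℤ/m`. -/
lemma sum_range_cw {m k l : ℕ} (hk : k < m) (hl : l < m) :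
    ∑ t ∈ Finset.range m, cw m ^ (k * t) * (cw m ^ (l * t))⁻¹ = if k = l then (m : ℂ) else 0 := by
  have h1 : ∀ t, cw m ^ (k * t) * (cw m ^ (l * t))⁻¹ = (cw m ^ k * (cw m ^ l)⁻¹) ^ t := by
    intro t; rw [mul_pow, inv_pow, ← pow_mul, ← pow_mul]
  simp_rw [h1]
  split_ifs with h
  · subst h
    rw [mul_inv_cancel₀ (pow_ne_zero _ (cw_ne_zero m))]; simp
  · have hne : cw m ^ k * (cw m ^ l)⁻¹ ≠ 1 := by
      intro h2
      rw [mul_inv_eq_one₀ (pow_ne_zero _ (cw_ne_zero m))] at h2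
      exact h ((cw_pow_eq_iff hk hl).1 h2)
    rw [geom_sum_eq hne, mul_pow, inv_pow, ← pow_mul, ← pow_mul, mul_comm k, mul_comm l, pow_mul,
      pow_mul, cw_pow_self (by omega)]
    simp

lemma sum_cw_shift {m k l : ℕ} (hk : k < m) (hl : l < m) :
    ∑ t : Fin m, cw m ^ (k * ((t : ℕ) + 1)) * (cw m ^ (l * ((t : ℕ) + 1)))⁻¹
      = if k = l then (m : ℂ) else 0 := by
  rw [Fin.sum_univ_eq_sum_range
    (fun t : ℕ => cw m ^ (k * (t + 1)) * (cw m ^ (l * (t + 1)))⁻¹) m]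
  have : ∀ t, cw m ^ (k * (t + 1)) * (cw m ^ (l * (t + 1)))⁻¹ =
      (cw m ^ k * (cw m ^ l)⁻¹) * (cw m ^ (k * t) * (cw m ^ (l * t))⁻¹) := by
    intro t
    rw [mul_add, mul_add, pow_add, pow_add, mul_inv]; ring_nf
  simp_rw [this, ← Finset.mul_sum]
  rw [sum_range_cw hk hl]
  split_ifs with h
  · subst h; rw [mul_inv_cancel₀ (pow_ne_zero _ (cw_ne_zero m)), one_mul]
  · simp

lemma sum_cw_shift_eq_zero {m k : ℕ} (hk : k < m) (hk0 : k ≠ 0) :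
    ∑ t : Fin m, cw m ^ (k * ((t : ℕ) + 1)) = 0 := by
  have := sum_cw_shift (l := 0) hk (by omega)
  simpa [hk0] using this

/-- Discrete Fourier inversion. -/
lemma sum_ucoef_mul_vvec {m : ℕ} (w : Fin m → ℝ) (i : Fin m) :
    ∑ k ∈ Finset.range m, ucoef m k w * vvec m k i = w i := by
  have hm : m ≠ 0 := by have := i.2; omega
  simp only [ucoef, vvec, zpow_neg, zpow_natCast, Finset.sum_mul]
  rw [Finset.sum_comm]
  have : ∀ t : Fin m, ∑ k ∈ Finset.range m, cw m ^ (k * (t : ℕ)) * (w t : ℂ) *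
      ((m : ℂ)⁻¹ * (cw m ^ (k * (i : ℕ)))⁻¹) =
        w t * ((m : ℂ)⁻¹ * if (t : ℕ) = i then (m : ℂ) else 0) := by
    intro t
    rw [← sum_range_cw t.2 i.2, Finset.mul_sum, Finset.mul_sum]
    refine Finset.sum_congr rfl fun k _ => ?_
    rw [mul_comm k, mul_comm k]; ring
  simp_rw [this]
  rw [Finset.sum_eq_single i]
  · have : (m : ℂ) ≠ 0 := by exact_mod_cast hm
    simp [this]
  · intro b _ hb
    have : ¬ ((b : ℕ) = i) := fun h => hb (Fin.ext h)
    simp [this]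
  · simp

lemma ucoef_zero (m : ℕ) (w : Fin m → ℝ) : ucoef m 0 w = ∑ i, (w i : ℂ) := by
  simp [ucoef]

lemma norm_vvec (m k : ℕ) (i : Fin m) : ‖vvec m k i‖ = (m : ℝ)⁻¹ := by
  simp [vvec, norm_cw, norm_zpow]

lemma vvec_zero (m : ℕ) (i : Fin m) : vvec m 0 i = (m : ℂ)⁻¹ := by simp [vvec]

lemma conj_vvec {m k : ℕ} (hk : k ≤ m) (i : Fin m) :
    (starRingEnd ℂ) (vvec m k i) = vvec m (m - k) i := by
  have hm : m ≠ 0 := by have := i.2; omega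
  simp only [vvec, zpow_neg, zpow_natCast, map_mul, map_inv₀, map_natCast]
  congr 2
  rw [pow_mul, pow_mul, map_pow, cw_pow_sub hm hk]

lemma ucoef_sub (m k : ℕ) (v w : Fin m → ℝ) :
    ucoef m k (fun i => v i - w i) = ucoef m k v - ucoef m k w := by
  simp [ucoef, mul_sub]

lemma conj_ucoef {m k : ℕ} (hk : k ≤ m) (w : Fin m → ℝ) :
    (starRingEnd ℂ) (ucoef m k w) = ucoef m (m - k) w := by
  rcases Nat.eq_zero_or_pos m with rfl | hm
  · simp [ucoef]
  simp only [ucoef, map_sum, map_mul, Complex.conj_ofReal]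
  refine Finset.sum_congr rfl fun i _ => ?_
  rw [pow_mul, pow_mul, map_pow, cw_pow_sub hm.ne' hk]

lemma norm_ucoef_le (m k : ℕ) (w : Fin m → ℝ) : ‖ucoef m k w‖ ≤ ∑ i, |w i| := by
  refine (norm_sum_le _ _).trans (Finset.sum_le_sum fun i _ => ?_)
  rw [norm_mul, norm_cw_pow, one_mul, Complex.norm_real, Real.norm_eq_abs]

lemma continuous_ucoef (m k : ℕ) : Continuous (ucoef m k) := by
  unfold ucoef; fun_prop

end Fourier

section Moments

variable {Ω : Type*} [MeasurableSpace Ω] {μ : Measure Ω} {m : ℕ} {j0 : Fin m}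
  {R : ℕ → Ω → Fin m → ℝ}

namespace IsCyclicUrn

lemma ucoef_drawSet (hm : 2 ≤ m) {n : ℕ} {j : Fin m} {ω : Ω} (h : ω ∈ drawSet m R n j) (k : ℕ) :
    ucoef m k (R (n + 1) ω) = ucoef m k (R n ω) + cw m ^ (k * ((j : ℕ) + 1)) := by
  rw [ucoef, sum_drawSet hm h (fun t => cw m ^ (k * (t : ℕ))), ucoef,
    cw_pow_mul_mod (by omega)]

lemma sum_proportion_mul_cw (n k : ℕ) (ω : Ω) :
    ∑ j : Fin m, ((R n ω j / (n + 1) : ℝ) : ℂ) * cw m ^ (k * ((j : ℕ) + 1))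
      = cw m ^ k / (n + 1) * ucoef m k (R n ω) := by
  rw [ucoef, Finset.mul_sum]
  refine Finset.sum_congr rfl fun j _ => ?_
  push_cast
  rw [mul_add, pow_add, mul_one]; ring

lemma ae_sum_proportion (hm : 2 ≤ m) (hR : IsCyclicUrn μ m j0 R) (n : ℕ) :
    ∀ᵐ ω ∂μ, ∑ j : Fin m, R n ω j / ((n : ℝ) + 1) = 1 := by
  filter_upwards [hR.ae_sum hm n] with ω h
  rw [← Finset.sum_div, h]; field_simp

lemma stronglyMeasurable_ucoef {n i : ℕ} (k : ℕ) (hi : i ≤ n) :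
    StronglyMeasurable[urnFilt m R n] (fun ω => ucoef m k (R i ω)) :=
  ((continuous_ucoef m k).measurable.comp (measurable_urnFilt hi)).stronglyMeasurable

lemma ae_norm_ucoef_le (hm : 2 ≤ m) (hR : IsCyclicUrn μ m j0 R) (n k : ℕ) :
    ∀ᵐ ω ∂μ, ‖ucoef m k (R n ω)‖ ≤ n + 1 := by
  filter_upwards [hR.ae_sum hm n] with ω h
  refine (norm_ucoef_le _ _ _).trans ?_
  rw [← h]
  exact (Finset.sum_congr rfl fun i _ => abs_of_nonneg (hR.nonneg n ω i)).le

lemma measurable_ucoef (hR : IsCyclicUrn μ m j0 R) (n k : ℕ) :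
    Measurable (fun ω => ucoef m k (R n ω)) :=
  (continuous_ucoef m k).measurable.comp (hR.meas n)

lemma integrable_ucoef (hm : 2 ≤ m) (hR : IsCyclicUrn μ m j0 R) (n k : ℕ) :
    Integrable (fun ω => ucoef m k (R n ω)) μ := by
  have := hR.isProb
  exact Integrable.of_bound (hR.measurable_ucoef n k).aestronglyMeasurable _
    (hR.ae_norm_ucoef_le hm n k)

lemma integrable_coord (hR : IsCyclicUrn μ m j0 R) (n : ℕ) (i : Fin m) :
    Integrable (fun ω => R n ω i) μ := by
  have h := (hR.integrable_proportion n i).mul_const ((n : ℝ) + 1)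
  refine h.congr (ae_of_all _ fun ω => ?_)
  have : (n : ℝ) + 1 ≠ 0 := by positivity
  simp only; field_simp

lemma integral_ucoef_eq (hR : IsCyclicUrn μ m j0 R) (n k : ℕ) :
    ∫ ω, ucoef m k (R n ω) ∂μ = ucoef m k (expVec μ (R n)) := by
  simp only [ucoef, expVec]
  rw [integral_finsetSum _ (fun i _ => ((hR.integrable_coord n i).ofReal).const_mul _)]
  refine Finset.sum_congr rfl fun i _ => ?_
  rw [integral_const_mul, integral_complex_ofReal]

lemma integral_ucoef_succ (hm : 2 ≤ m) (hR : IsCyclicUrn μ m j0 R) (n k : ℕ) :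
    ∫ ω, ucoef m k (R (n + 1) ω) ∂μ =
      (1 + cw m ^ k / (n + 1)) * ∫ ω, ucoef m k (R n ω) ∂μ := by
  have := hR.isProb
  rw [hR.integral_step hm n (fun j ω => ucoef m k (R n ω) + cw m ^ (k * ((j : ℕ) + 1)))
    (fun j => (stronglyMeasurable_ucoef k le_rfl).add stronglyMeasurable_const)
    (fun j => (hR.integrable_ucoef hm n k).add (integrable_const _)) _
    (fun j ω h => ucoef_drawSet hm h k), ← integral_const_mul]
  refine integral_congr_ae ?_
  filter_upwards [hR.ae_sum_proportion hm n] with ω h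
  rw [Finset.sum_congr rfl (fun j _ => mul_add _ _ _), Finset.sum_add_distrib,
    ← Finset.sum_mul, sum_proportion_mul_cw, ← Complex.ofReal_sum, h]
  push_cast; ring

/-- Conditional expansion of a squared norm along one draw. -/
lemma sum_mul_norm_add_sq {p : Fin m → ℝ} (hp : ∑ j, p j = 1) (q : ℂ) (d : Fin m → ℂ) :
    ∑ j, p j * ‖q + d j‖ ^ 2 = ‖q‖ ^ 2 + 2 * ((starRingEnd ℂ q) * ∑ j, (p j : ℂ) * d j).re
      + ∑ j, p j * ‖d j‖ ^ 2 := by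
  have h : ∀ j, p j * ‖q + d j‖ ^ 2 = p j * ‖q‖ ^ 2 +
      2 * ((starRingEnd ℂ q) * ((p j : ℂ) * d j)).re + p j * ‖d j‖ ^ 2 := by
    intro j
    simp only [← Complex.normSq_eq_norm_sq, Complex.normSq_apply]
    simp
    ring
  simp_rw [h, Finset.sum_add_distrib, ← Finset.sum_mul, hp, ← Finset.mul_sum, ← Complex.re_sum,
    ← Finset.mul_sum]
  ring

lemma integral_step_real (hm : 2 ≤ m) (hR : IsCyclicUrn μ m j0 R) (n : ℕ) (G : Fin m → Ω → ℝ)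
    (hG : ∀ j, StronglyMeasurable[urnFilt m R n] (G j)) (hGi : ∀ j, Integrable (G j) μ)
    (T : Ω → ℝ) (hT : ∀ j, ∀ ω ∈ drawSet m R n j, T ω = G j ω) :
    ∫ ω, T ω ∂μ = ∫ ω, ∑ j, (R n ω j / (n + 1)) * G j ω ∂μ := by
  have := hR.integral_step hm n (fun j ω => (G j ω : ℂ))
    (fun j => Complex.continuous_ofReal.comp_stronglyMeasurable (hG j)) (fun j => (hGi j).ofReal)
    (fun ω => (T ω : ℂ)) (fun j ω h => by rw [hT j ω h])
  rw [integral_complex_ofReal] at this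
  rw [← Complex.ofReal_inj, this, ← integral_complex_ofReal]
  push_cast; rfl

lemma integral_norm_ucoef_sq_succ (hm : 2 ≤ m) (hR : IsCyclicUrn μ m j0 R) (n k : ℕ) :
    ∫ ω, ‖ucoef m k (R (n + 1) ω)‖ ^ 2 ∂μ =
      (1 + 2 * lam m k / (n + 1)) * ∫ ω, ‖ucoef m k (R n ω)‖ ^ 2 ∂μ + 1 := by
  have := hR.isProb
  have hinteg : Integrable (fun ω => ‖ucoef m k (R n ω)‖ ^ 2) μ := by
    refine Integrable.of_bound (C := ((n : ℝ) + 1) ^ 2)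
      ((hR.measurable_ucoef n k).norm.pow_const 2).aestronglyMeasurable ?_
    filter_upwards [hR.ae_norm_ucoef_le hm n k] with ω h
    rw [norm_pow, norm_norm]
    gcongr
  have hsm : ∀ j : Fin m, Measurable[urnFilt m R n]
      (fun ω => ‖ucoef m k (R n ω) + cw m ^ (k * ((j : ℕ) + 1))‖ ^ 2) := fun j =>
    (((stronglyMeasurable_ucoef k le_rfl).add stronglyMeasurable_const).norm.pow 2).measurable
  rw [hR.integral_step_real hm n
    (fun j ω => ‖ucoef m k (R n ω) + cw m ^ (k * ((j : ℕ) + 1))‖ ^ 2)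
    (fun j => (hsm j).stronglyMeasurable) (fun j => ?_) _
    (fun j ω h => by rw [ucoef_drawSet hm h k])]
  · have : (fun ω => ∑ j : Fin m, (R n ω j / ((n : ℝ) + 1)) *
        ‖ucoef m k (R n ω) + cw m ^ (k * ((j : ℕ) + 1))‖ ^ 2) =ᵐ[μ]
        fun ω => (1 + 2 * lam m k / (n + 1)) * ‖ucoef m k (R n ω)‖ ^ 2 + 1 := by
      filter_upwards [hR.ae_sum_proportion hm n] with ω h
      rw [sum_mul_norm_add_sq h, sum_proportion_mul_cw]
      simp_rw [norm_cw_pow, one_pow, mul_one, h]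
      rw [mul_left_comm, ← Complex.normSq_eq_conj_mul_self, Complex.re_mul_ofReal,
        Complex.normSq_eq_norm_sq]
      have : (cw m ^ k / ((n : ℂ) + 1)).re = lam m k / (n + 1) := by
        rw [← cw_pow_re]
        have : ((n : ℂ) + 1) = ((n + 1 : ℝ) : ℂ) := by push_cast; rfl
        rw [this, Complex.div_ofReal_re]
      rw [this]; ring
    rw [integral_congr_ae this, integral_add (hinteg.const_mul _) (integrable_const _),
      integral_const_mul]
    simp
  · refine Integrable.of_bound (C := ((n : ℝ) + 1 + 1) ^ 2)
      ((hsm j).mono (hR.urnFilt_le n) le_rfl).aestronglyMeasurable ?_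
    filter_upwards [hR.ae_norm_ucoef_le hm n k] with ω h
    rw [norm_pow, norm_norm]
    gcongr
    refine (norm_add_le _ _).trans ?_
    rw [norm_cw_pow]; gcongr

end IsCyclicUrn

end Moments

section CharFunStep

/-- Quantitative comparison between the characteristic function of a centred, finitely supported
variable whose law is close to uniform and a Gaussian factor. -/
lemma norm_sum_exp_sub_le {m : ℕ} {p x : Fin m → ℝ} {M : ℝ} (hp0 : ∀ j, 0 ≤ p j)
    (hp1 : ∑ j, p j = 1) (hM : ∀ j, |x j| ≤ M) (hx : ∑ j, x j = 0) :
    ‖∑ j, (p j : ℂ) * Complex.exp (((x j - ∑ l, p l * x l : ℝ) : ℂ) * Complex.I)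
        - ((Real.exp (-((∑ j, x j ^ 2) / m) / 2) : ℝ) : ℂ)‖
      ≤ 16 * M ^ 3 + M ^ 2 * ∑ j, |p j - 1 / m| := by
  have hm : 0 < m := by
    rcases Nat.eq_zero_or_pos m with rfl | h
    · simp at hp1
    · exact h
  have hm' : (0 : ℝ) < m := by exact_mod_cast hm
  have hM0 : 0 ≤ M := (abs_nonneg _).trans (hM ⟨0, hm⟩)
  set c := ∑ l, p l * x l with hc
  set d := ∑ j, |p j - 1 / m| with hd
  set s := (∑ j, x j ^ 2) / m with hs
  have hd0 : 0 ≤ d := Finset.sum_nonneg fun _ _ => abs_nonneg _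
  have hs0 : 0 ≤ s := by positivity
  rcases le_or_gt M (1 / 2) with hM2 | hM2
  · have hcM : |c| ≤ M := by
      calc |c| ≤ ∑ l, |p l * x l| := Finset.abs_sum_le_sum_abs _ _
        _ ≤ ∑ l, p l * M := Finset.sum_le_sum fun l _ => by
            rw [abs_mul, abs_of_nonneg (hp0 l)]
            exact mul_le_mul_of_nonneg_left (hM l) (hp0 l)
        _ = M := by rw [← Finset.sum_mul, hp1, one_mul]
    have hcd : |c| ≤ M * d := by
      have : c = ∑ l, (p l - 1 / m) * x l := by
        simp_rw [sub_mul, Finset.sum_sub_distrib, ← Finset.mul_sum, hx]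
        simp [hc]
      rw [this, hd, Finset.mul_sum]
      refine (Finset.abs_sum_le_sum_abs _ _).trans (Finset.sum_le_sum fun l _ => ?_)
      rw [abs_mul, mul_comm]
      exact mul_le_mul_of_nonneg_right (hM l) (abs_nonneg _)
    have hc2 : c ^ 2 ≤ M ^ 2 * d := by
      rw [← sq_abs, sq, sq, mul_assoc]
      exact mul_le_mul hcM hcd (abs_nonneg _) hM0
    have hy : ∀ j, |x j - c| ≤ 2 * M := fun j => by
      calc |x j - c| ≤ |x j| + |c| := abs_sub _ _
        _ ≤ 2 * M := by linarith [hM j]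
    have hsM : s ≤ M ^ 2 := by
      rw [hs, div_le_iff₀ hm']
      calc ∑ j, x j ^ 2 ≤ ∑ _j : Fin m, M ^ 2 := Finset.sum_le_sum fun j _ => by
            rw [← sq_abs]; exact pow_le_pow_left₀ (abs_nonneg _) (hM j) 2
        _ = M ^ 2 * m := by simp; ring
    set q := ∑ j, p j * (x j - c) ^ 2 with hq
    have hq' : q = ∑ j, p j * x j ^ 2 - c ^ 2 := by
      have : ∀ j, p j * (x j - c) ^ 2 = p j * x j ^ 2 - 2 * c * (p j * x j) + p j * c ^ 2 := by
        intro j; ring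
      rw [hq]
      simp_rw [this, Finset.sum_add_distrib, Finset.sum_sub_distrib, ← Finset.mul_sum,
        ← Finset.sum_mul, hp1, ← hc]
      ring
    have hqs : |q - s| ≤ 2 * M ^ 2 * d := by
      have h1 : q - s = ∑ j, (p j - 1 / m) * x j ^ 2 - c ^ 2 := by
        simp_rw [sub_mul, Finset.sum_sub_distrib, ← Finset.mul_sum]
        rw [hq', hs]; ring
      have h2 : |∑ j, (p j - 1 / m) * x j ^ 2| ≤ M ^ 2 * d := by
        rw [hd, Finset.mul_sum]
        refine (Finset.abs_sum_le_sum_abs _ _).trans (Finset.sum_le_sum fun l _ => ?_)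
        rw [abs_mul, mul_comm, abs_pow]
        exact mul_le_mul_of_nonneg_right (pow_le_pow_left₀ (abs_nonneg _) (hM l) 2) (abs_nonneg _)
      rw [h1]
      calc _ ≤ |∑ j, (p j - 1 / m) * x j ^ 2| + |c ^ 2| := abs_sub _ _
        _ ≤ _ := by rw [abs_of_nonneg (sq_nonneg c)]; linarith
    have hexp : ∀ j, ‖Complex.exp (((x j - c : ℝ) : ℂ) * Complex.I) -
        (1 + ((x j - c : ℝ) : ℂ) * Complex.I - (((x j - c) ^ 2 / 2 : ℝ) : ℂ))‖ ≤ 8 * M ^ 3 := by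
      intro j
      have hn : ‖((x j - c : ℝ) : ℂ) * Complex.I‖ = |x j - c| := by
        rw [norm_mul, Complex.norm_I, mul_one, Complex.norm_real, Real.norm_eq_abs]
      have h := Complex.exp_bound (x := ((x j - c : ℝ) : ℂ) * Complex.I)
        (by rw [hn]; linarith [hy j]) (n := 3) (by norm_num)
      rw [hn] at h
      simp only [Finset.sum_range_succ, Finset.sum_range_zero, Nat.factorial, pow_zero,
        pow_one] at h
      have h3 : |x j - c| ^ 3 ≤ (2 * M) ^ 3 := pow_le_pow_left₀ (abs_nonneg _) (hy j) 3
      have h4 : (0 : ℝ) ≤ |x j - c| ^ 3 := by positivity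
      calc _ = _ := by
            congr 1
            push_cast
            rw [mul_pow, Complex.I_sq]; ring
        _ ≤ _ := h
        _ ≤ 8 * M ^ 3 := by norm_num; nlinarith
    have hmain : ‖∑ j, (p j : ℂ) * Complex.exp (((x j - c : ℝ) : ℂ) * Complex.I)
        - ((1 - q / 2 : ℝ) : ℂ)‖ ≤ 8 * M ^ 3 := by
      have h1 : ((1 - q / 2 : ℝ) : ℂ) = ∑ j, (p j : ℂ) *
          (1 + ((x j - c : ℝ) : ℂ) * Complex.I - (((x j - c) ^ 2 / 2 : ℝ) : ℂ)) := by
        have h2 : ∑ j, p j * (x j - c) = 0 := by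
          simp_rw [mul_sub, Finset.sum_sub_distrib, ← Finset.sum_mul, hp1, ← hc]; ring
        have h3 : q / 2 = ∑ j, p j * ((x j - c) ^ 2 / 2) := by
          rw [hq, Finset.sum_div]; exact Finset.sum_congr rfl fun j _ => by ring
        have h4 : ∀ j, (p j : ℂ) *
          (1 + ((x j - c : ℝ) : ℂ) * Complex.I - (((x j - c) ^ 2 / 2 : ℝ) : ℂ)) =
            (p j : ℂ) + ((p j * (x j - c) : ℝ) : ℂ) * Complex.I
              - ((p j * ((x j - c) ^ 2 / 2) : ℝ) : ℂ) := by
          intro j; push_cast; ring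
        simp_rw [h4, Finset.sum_sub_distrib, Finset.sum_add_distrib, ← Finset.sum_mul,
          ← Complex.ofReal_sum, h2, hp1, h3]
        push_cast; ring
      rw [h1, ← Finset.sum_sub_distrib]
      calc _ ≤ ∑ j, ‖(p j : ℂ) * Complex.exp (((x j - c : ℝ) : ℂ) * Complex.I) - (p j : ℂ) *
          (1 + ((x j - c : ℝ) : ℂ) * Complex.I - (((x j - c) ^ 2 / 2 : ℝ) : ℂ))‖ := norm_sum_le _ _
        _ ≤ ∑ j, p j * (8 * M ^ 3) := Finset.sum_le_sum fun j _ => by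
            rw [← mul_sub, norm_mul, Complex.norm_real, Real.norm_eq_abs, abs_of_nonneg (hp0 j)]
            exact mul_le_mul_of_nonneg_left (hexp j) (hp0 j)
        _ = _ := by rw [← Finset.sum_mul, hp1, one_mul]
    have hgauss : |1 - q / 2 - Real.exp (-s / 2)| ≤ M ^ 2 * d + M ^ 3 := by
      have h1 : |Real.exp (-s / 2) - 1 - (-s / 2)| ≤ (-s / 2) ^ 2 :=
        Real.abs_exp_sub_one_sub_id_le (by rw [abs_le]; constructor <;> nlinarith)
      have h2 : (-s / 2) ^ 2 ≤ M ^ 3 := by nlinarith [mul_nonneg hM0 hM0, mul_nonneg hs0 hs0]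
      rw [abs_le] at h1 hqs ⊢
      constructor <;> nlinarith
    calc _ ≤ ‖∑ j, (p j : ℂ) * Complex.exp (((x j - c : ℝ) : ℂ) * Complex.I)
        - ((1 - q / 2 : ℝ) : ℂ)‖ + ‖((1 - q / 2 : ℝ) : ℂ) - ((Real.exp (-s / 2) : ℝ) : ℂ)‖ :=
          norm_sub_le_norm_sub_add_norm_sub _ _ _
      _ ≤ 8 * M ^ 3 + (M ^ 2 * d + M ^ 3) := by
          refine add_le_add hmain ?_
          rw [← Complex.ofReal_sub, Complex.norm_real, Real.norm_eq_abs]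
          exact hgauss
      _ ≤ _ := by nlinarith [pow_nonneg hM0 3]
  · have h1 : ‖∑ j, (p j : ℂ) * Complex.exp (((x j - c : ℝ) : ℂ) * Complex.I)‖ ≤ 1 := by
      refine (norm_sum_le _ _).trans ?_
      simp_rw [norm_mul, Complex.norm_exp_ofReal_mul_I, mul_one, Complex.norm_real,
        Real.norm_eq_abs]
      rw [Finset.sum_congr rfl fun j _ => abs_of_nonneg (hp0 j), hp1]
    have h2 : ‖((Real.exp (-s / 2) : ℝ) : ℂ)‖ ≤ 1 := by
      rw [Complex.norm_real, Real.norm_eq_abs, Real.abs_exp]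
      exact Real.exp_le_one_iff.2 (by linarith)
    have h3 : (1 / 2 : ℝ) ^ 3 ≤ M ^ 3 := pow_le_pow_left₀ (by norm_num) hM2.le 3
    have h4 : 0 ≤ M ^ 2 * d := by positivity
    refine (norm_sub_le _ _).trans ?_
    norm_num at h3
    linarith

variable {Ω : Type*} [MeasurableSpace Ω] {μ : Measure Ω} {m : ℕ} {j0 : Fin m}
  {R : ℕ → Ω → Fin m → ℝ}

/-- Mean distance of the urn composition from the uniform composition. -/
def meanDev (μ : Measure Ω) (R : ℕ → Ω → Fin m → ℝ) (n : ℕ) : ℝ :=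
  ∫ ω, ∑ j, |R n ω j / (n + 1) - 1 / m| ∂μ

namespace IsCyclicUrn

lemma integrable_dev (hR : IsCyclicUrn μ m j0 R) (n : ℕ) :
    Integrable (fun ω => ∑ j, |R n ω j / ((n : ℝ) + 1) - 1 / m|) μ := by
  have := hR.isProb
  exact integrable_finsetSum _ fun j _ =>
    ((hR.integrable_proportion n j).sub (integrable_const _)).abs

/-- Gaussian approximation for sums of centred increments driven by the urn. -/
lemma norm_charFun_sub_le (hm : 2 ≤ m) (hR : IsCyclicUrn μ m j0 R) {x : ℕ → Fin m → ℝ}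
    {M : ℕ → ℝ} (hM : ∀ i j, |x i j| ≤ M i) (hx : ∀ i, ∑ j, x i j = 0) {ξ : ℕ → Ω → ℝ}
    (hξm : ∀ i, Measurable[urnFilt m R (i + 1)] (ξ i))
    (hξ : ∀ i j, ∀ ω ∈ drawSet m R i j, ξ i ω = x i j - ∑ l, R i ω l / (i + 1) * x i l) (N : ℕ) :
    ‖∫ ω, Complex.exp (((∑ i ∈ Finset.range N, ξ i ω : ℝ) : ℂ) * Complex.I) ∂μ
        - ((Real.exp (-(∑ i ∈ Finset.range N, (∑ j, x i j ^ 2) / m) / 2) : ℝ) : ℂ)‖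
      ≤ ∑ i ∈ Finset.range N, (16 * M i ^ 3 + M i ^ 2 * meanDev μ R i) := by
  have := hR.isProb
  induction N with
  | zero => simp
  | succ N ih =>
    set s : ℝ := (∑ j, x N j ^ 2) / m with hs
    have hs0 : 0 ≤ s := by positivity
    set S : Ω → ℝ := fun ω => ∑ i ∈ Finset.range N, ξ i ω with hS
    have hSm : Measurable[urnFilt m R N] S :=
      @Finset.measurable_sum _ _ _ _ _ _ (urnFilt m R N) _ _ fun i hi =>
        (hξm i).mono (urnFilt_mono (by simp at hi; omega)) le_rfl
    have hcm : ∀ j : Fin m, Measurable[urnFilt m R N]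
        (fun ω => S ω + (x N j - ∑ l, R N ω l / ((N : ℝ) + 1) * x N l)) := by
      intro j
      have h1 : Measurable (fun r : Fin m → ℝ => x N j - ∑ l, r l / ((N : ℝ) + 1) * x N l) := by
        fun_prop
      exact hSm.add (h1.comp (measurable_urnFilt (R := R) le_rfl))
    have hexpc : Measurable (fun y : ℝ => Complex.exp ((y : ℂ) * Complex.I)) := by fun_prop
    have hstep := hR.integral_step hm N
      (fun j ω => Complex.exp (((S ω + (x N j - ∑ l, R N ω l / ((N : ℝ) + 1) * x N l) : ℝ) : ℂ)
        * Complex.I))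
      (fun j => (hexpc.comp (hcm j)).stronglyMeasurable)
      (fun j => Integrable.of_bound (C := 1)
        ((hexpc.comp (hcm j)).mono (hR.urnFilt_le N) le_rfl).aestronglyMeasurable
        (ae_of_all _ fun ω => by rw [Complex.norm_exp_ofReal_mul_I]))
      (fun ω => Complex.exp (((∑ i ∈ Finset.range (N + 1), ξ i ω : ℝ) : ℂ) * Complex.I))
      (fun j ω h => by rw [Finset.sum_range_succ, hξ N j ω h])
    have hSmeas : Measurable S := hSm.mono (hR.urnFilt_le N) le_rfl
    have hintS : Integrable (fun ω => Complex.exp ((S ω : ℂ) * Complex.I)) μ :=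
      Integrable.of_bound (C := 1) (hexpc.comp hSmeas).aestronglyMeasurable
        (ae_of_all _ fun ω => by rw [Complex.norm_exp_ofReal_mul_I])
    have hRm : ∀ l, Measurable fun ω => R N ω l := fun l =>
      (measurable_pi_apply l).comp (hR.meas N)
    have hP1 : Measurable (fun ω => ∑ j, ((R N ω j / ((N : ℝ) + 1) : ℝ) : ℂ) *
        Complex.exp (((S ω + (x N j - ∑ l, R N ω l / ((N : ℝ) + 1) * x N l) : ℝ) : ℂ)
        * Complex.I)) := by
      fun_prop
    have hbound : ∀ᵐ ω ∂μ, ‖∑ j, ((R N ω j / ((N : ℝ) + 1) : ℝ) : ℂ) *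
        Complex.exp (((S ω + (x N j - ∑ l, R N ω l / ((N : ℝ) + 1) * x N l) : ℝ) : ℂ)
        * Complex.I) - ((Real.exp (-s / 2) : ℝ) : ℂ) * Complex.exp ((S ω : ℂ) * Complex.I)‖
        ≤ 16 * M N ^ 3 + M N ^ 2 * ∑ j, |R N ω j / ((N : ℝ) + 1) - 1 / m| := by
      filter_upwards [hR.ae_sum_proportion hm N] with ω h
      have h1 := norm_sum_exp_sub_le
        (fun j => div_nonneg (hR.nonneg N ω j) (by positivity : (0 : ℝ) ≤ (N : ℝ) + 1)) h
        (hM N) (hx N)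
      have h2 : ∀ j, ((R N ω j / ((N : ℝ) + 1) : ℝ) : ℂ) *
          Complex.exp (((S ω + (x N j - ∑ l, R N ω l / ((N : ℝ) + 1) * x N l) : ℝ) : ℂ)
          * Complex.I) = Complex.exp ((S ω : ℂ) * Complex.I) * (((R N ω j / ((N : ℝ) + 1) : ℝ) : ℂ)
          * Complex.exp (((x N j - ∑ l, R N ω l / ((N : ℝ) + 1) * x N l : ℝ) : ℂ) * Complex.I)) := by
        intro j
        rw [Complex.ofReal_add, add_mul, Complex.exp_add]; ring
      simp_rw [h2]
      rw [← Finset.mul_sum, mul_comm (((Real.exp (-s / 2) : ℝ) : ℂ)), ← mul_sub, norm_mul,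
        Complex.norm_exp_ofReal_mul_I, one_mul]
      exact h1
    have hdiff : ‖∫ ω, Complex.exp (((∑ i ∈ Finset.range (N + 1), ξ i ω : ℝ) : ℂ) * Complex.I) ∂μ
        - ((Real.exp (-s / 2) : ℝ) : ℂ) * ∫ ω, Complex.exp ((S ω : ℂ) * Complex.I) ∂μ‖
        ≤ 16 * M N ^ 3 + M N ^ 2 * meanDev μ R N := by
      rw [hstep, ← integral_const_mul, ← integral_sub]
      · refine (norm_integral_le_of_norm_le ?_ hbound).trans (le_of_eq ?_)
        · exact (integrable_const _).add ((hR.integrable_dev N).const_mul _)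
        · rw [integral_add (integrable_const _) ((hR.integrable_dev N).const_mul _)]
          simp [meanDev, integral_const_mul]
      · refine Integrable.of_bound (C := 1) hP1.aestronglyMeasurable ?_
        filter_upwards [hR.ae_sum_proportion hm N] with ω h
        refine (norm_sum_le _ _).trans ?_
        simp_rw [norm_mul, Complex.norm_exp_ofReal_mul_I, mul_one, Complex.norm_real,
          Real.norm_eq_abs]
        rw [Finset.sum_congr rfl fun j _ => abs_of_nonneg
          (div_nonneg (hR.nonneg N ω j) (by positivity : (0 : ℝ) ≤ (N : ℝ) + 1)), h]
      · exact hintS.const_mul _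
    have hexp : ((Real.exp (-(∑ i ∈ Finset.range (N + 1), (∑ j, x i j ^ 2) / m) / 2) : ℝ) : ℂ) =
        ((Real.exp (-s / 2) : ℝ) : ℂ) *
          ((Real.exp (-(∑ i ∈ Finset.range N, (∑ j, x i j ^ 2) / m) / 2) : ℝ) : ℂ) := by
      rw [← Complex.ofReal_mul, ← Real.exp_add, Finset.sum_range_succ, ← hs]
      congr 2; ring
    rw [hexp, Finset.sum_range_succ, add_comm (Finset.sum _ _)]
    refine (norm_sub_le_norm_sub_add_norm_sub _ _ _).trans (add_le_add hdiff ?_)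
    rw [← mul_sub, norm_mul, Complex.norm_real, Real.norm_eq_abs, Real.abs_exp]
    exact (mul_le_of_le_one_left (norm_nonneg _)
      (Real.exp_le_one_iff.2 (by linarith))).trans ih

end IsCyclicUrn

end CharFunStep

section Sequences

lemma tendsto_zero_of_le_one_sub_div {x : ℕ → ℝ} {c : ℝ} (hc : 0 < c) (hx : ∀ n, 0 ≤ x n) (N : ℕ)
    (h : ∀ n, N ≤ n → x (n + 1) ≤ (1 - c / (n + 1)) * x n) : Tendsto x atTop (𝓝 0) := by
  set H : ℕ → ℝ := fun n => ∑ i ∈ Finset.range n, (1 / ((i : ℝ) + 1)) with hH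
  have hle : ∀ n, N ≤ n → x n ≤ (x N * Real.exp (c * H N)) * Real.exp (-(c * H n)) := by
    intro n hn
    induction n, hn using Nat.le_induction with
    | base => rw [mul_assoc, ← Real.exp_add]; simp
    | succ n hn ih =>
      have h1 : 1 - c / ((n : ℝ) + 1) ≤ Real.exp (-(c / ((n : ℝ) + 1))) := by
        have := Real.add_one_le_exp (-(c / ((n : ℝ) + 1)))
        linarith
      have h2 : H (n + 1) = H n + 1 / ((n : ℝ) + 1) := by
        rw [hH]; simp only; rw [Finset.sum_range_succ]
      calc x (n + 1) ≤ (1 - c / ((n : ℝ) + 1)) * x n := h n hn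
        _ ≤ Real.exp (-(c / ((n : ℝ) + 1))) * x n := mul_le_mul_of_nonneg_right h1 (hx n)
        _ ≤ Real.exp (-(c / ((n : ℝ) + 1))) *
            ((x N * Real.exp (c * H N)) * Real.exp (-(c * H n))) :=
          mul_le_mul_of_nonneg_left ih (Real.exp_pos _).le
        _ = _ := by
          rw [mul_left_comm, ← Real.exp_add, h2]; congr 2; ring
  have hlim : Tendsto (fun n => (x N * Real.exp (c * H N)) * Real.exp (-(c * H n))) atTop
      (𝓝 0) := by
    rw [← mul_zero (x N * Real.exp (c * H N))]
    refine Tendsto.const_mul _ (Real.tendsto_exp_neg_atTop_nhds_zero.comp ?_)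
    exact Real.tendsto_sum_range_one_div_nat_succ_atTop.const_mul_atTop hc
  exact squeeze_zero' (Eventually.of_forall hx)
    ((eventually_ge_atTop N).mono fun n hn => hle n hn) hlim

/-- A Toeplitz-type lemma for averages with vanishing weights. -/
lemma tendsto_tsum_mul_zero {w : ℕ → ℕ → ℝ} {δ : ℕ → ℝ} {C : ℝ} (hw : ∀ n i, 0 ≤ w n i)
    (hs : ∀ᶠ n in atTop, Summable (w n) ∧ ∑' i, w n i ≤ C)
    (h0 : ∀ i, Tendsto (fun n => w n i) atTop (𝓝 0)) (hδ : Tendsto δ atTop (𝓝 0)) :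
    Tendsto (fun n => ∑' i, w n i * δ i) atTop (𝓝 0) := by
  obtain ⟨B, hB⟩ : ∃ B, ∀ i, |δ i| ≤ B := by
    obtain ⟨B, hB⟩ := (Metric.isBounded_range_of_tendsto δ hδ).exists_norm_le
    exact ⟨B, fun i => hB _ ⟨i, rfl⟩⟩
  have hB0 : 0 ≤ B := (abs_nonneg _).trans (hB 0)
  have hC : 0 ≤ C := by
    obtain ⟨n, hn⟩ := hs.exists
    exact (tsum_nonneg (hw n)).trans hn.2
  rw [Metric.tendsto_atTop']
  intro ε hε
  have hε' : 0 < ε / (2 * (C + 1)) := by positivity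
  obtain ⟨I, hI⟩ := (Metric.tendsto_atTop.1 hδ) _ hε'
  have hfin : Tendsto (fun n => ∑ i ∈ Finset.range I, w n i * B) atTop (𝓝 0) := by
    have := tendsto_finsetSum (Finset.range I) (fun i _ => (h0 i).mul_const B)
    simpa using this
  obtain ⟨n0, hn0⟩ := eventually_atTop.1
    (hs.and (hfin.eventually (gt_mem_nhds (half_pos hε))))
  refine ⟨n0, fun n hn => ?_⟩
  obtain ⟨⟨hsum, hle⟩, hlt⟩ := hn0 n hn.le
  have hbound : ∀ i, ‖w n i * δ i‖ ≤
      (if i ∈ Finset.range I then w n i * B else 0) + w n i * (ε / (2 * (C + 1))) := by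
    intro i
    rw [norm_mul, Real.norm_eq_abs, Real.norm_eq_abs, abs_of_nonneg (hw n i)]
    split_ifs with hi
    · have := mul_le_mul_of_nonneg_left (hB i) (hw n i)
      have := mul_nonneg (hw n i) hε'.le
      linarith
    · have h1 := hI i (by simpa using hi)
      rw [dist_zero_right, Real.norm_eq_abs] at h1
      rw [zero_add]
      exact mul_le_mul_of_nonneg_left h1.le (hw n i)
  have hS : HasSum (fun i => (if i ∈ Finset.range I then w n i * B else 0)
      + w n i * (ε / (2 * (C + 1))))
      (∑ i ∈ Finset.range I, w n i * B + (∑' i, w n i) * (ε / (2 * (C + 1)))) := by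
    refine HasSum.add ?_ (hsum.hasSum.mul_right _)
    have h1 : HasSum (fun i => if i ∈ Finset.range I then w n i * B else 0)
        (∑ i ∈ Finset.range I, if i ∈ Finset.range I then w n i * B else 0) :=
      hasSum_sum_of_ne_finset_zero fun b hb => if_neg hb
    rwa [Finset.sum_congr rfl fun i hi => if_pos hi] at h1
  have h2 := tsum_of_norm_bounded hS hbound
  rw [dist_zero_right]
  have h3 : (∑' i, w n i) * (ε / (2 * (C + 1))) ≤ C * (ε / (2 * (C + 1))) :=
    mul_le_mul_of_nonneg_right hle hε'.le
  have h4 : C * (ε / (2 * (C + 1))) ≤ ε / 2 := by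
    rw [mul_div_assoc', div_le_div_iff₀ (by positivity) (by norm_num)]
    nlinarith
  linarith

end Sequences

section Weights

/-- The products `∏_{i ≤ j < n} (1 + z / (j + 1))`. -/
def growth (z : ℂ) (i n : ℕ) : ℂ := ∏ j ∈ Finset.Ico i n, (1 + z / ((j : ℂ) + 1))

/-- The drift `n ‖1 + z / (n + 1)‖² - (n + 1)` for `‖z‖ = 1`. -/
def drift (z : ℂ) (i : ℕ) : ℝ :=
  (2 * z.re - 1) * (1 - 1 / ((i : ℝ) + 1)) - (1 / ((i : ℝ) + 1)) ^ 2

/-- Coefficient of the `i`-th martingale increment in the residual at time `n`. -/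
def coeff (z : ℂ) (n i : ℕ) : ℂ :=
  if z.re < 1 / 2 then (if i < n then growth z (i + 1) n else 0)
  else (if i < n then 0 else -(growth z n (i + 1))⁻¹)

variable {z : ℂ}

lemma growth_self (z : ℂ) (n : ℕ) : growth z n n = 1 := by simp [growth]

lemma growth_of_le (z : ℂ) {i n : ℕ} (h : n ≤ i) : growth z i n = 1 := by
  simp [growth, Finset.Ico_eq_empty_of_le h]

lemma growth_succ_right (z : ℂ) {i n : ℕ} (h : i ≤ n) :
    growth z i (n + 1) = growth z i n * (1 + z / ((n : ℂ) + 1)) := by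
  rw [growth, Finset.prod_Ico_succ_top h, growth]

lemma growth_succ_left (z : ℂ) {i n : ℕ} (h : i < n) :
    growth z i n = (1 + z / ((i : ℂ) + 1)) * growth z (i + 1) n := by
  rw [growth, Finset.prod_eq_prod_Ico_succ_bot h, growth]

lemma growth_mul (z : ℂ) {i k n : ℕ} (h1 : i ≤ k) (h2 : k ≤ n) :
    growth z i k * growth z k n = growth z i n := Finset.prod_Ico_consecutive _ h1 h2

lemma growth_conj (z : ℂ) (i n : ℕ) :
    growth ((starRingEnd ℂ) z) i n = (starRingEnd ℂ) (growth z i n) := by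
  simp [growth, map_prod]

lemma coeff_conj (z : ℂ) (n i : ℕ) :
    coeff ((starRingEnd ℂ) z) n i = (starRingEnd ℂ) (coeff z n i) := by
  simp only [coeff, growth_conj, Complex.conj_re]
  split_ifs <;> simp

lemma coeff_of_lt (h : z.re < 1 / 2) {n i : ℕ} (hi : i < n) :
    coeff z n i = growth z (i + 1) n := by
  rw [coeff, if_pos h, if_pos hi]

lemma coeff_of_not_lt (h : z.re < 1 / 2) {n i : ℕ} (hi : ¬ i < n) : coeff z n i = 0 := by
  rw [coeff, if_pos h, if_neg hi]

lemma coeff_eq_zero (h : 1 / 2 < z.re) {n i : ℕ} (hi : i < n) : coeff z n i = 0 := by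
  rw [coeff, if_neg h.not_gt, if_pos hi]

lemma coeff_of_le (h : 1 / 2 < z.re) {n i : ℕ} (hi : ¬ i < n) :
    coeff z n i = -(growth z n (i + 1))⁻¹ := by
  rw [coeff, if_neg h.not_gt, if_neg hi]

lemma norm_one_add_div_sq (hz : ‖z‖ = 1) (i : ℕ) :
    (i : ℝ) * ‖1 + z / ((i : ℂ) + 1)‖ ^ 2 = (i + 1) + drift z i := by
  have h1 : (1 : ℂ) + z / ((i : ℂ) + 1) = (((i + 1 : ℝ) : ℂ) + z) / ((i + 1 : ℝ) : ℂ) := by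
    have : ((i : ℂ) + 1) ≠ 0 := by exact_mod_cast Nat.succ_ne_zero i
    push_cast; field_simp
  have h2 : z.re * z.re + z.im * z.im = 1 := by
    rw [← Complex.normSq_apply, Complex.normSq_eq_norm_sq, hz, one_pow]
  have h3 : ‖((i + 1 : ℝ) : ℂ) + z‖ ^ 2 = (i + 1) ^ 2 + 2 * z.re * (i + 1) + 1 := by
    rw [← Complex.normSq_eq_norm_sq, Complex.normSq_apply]
    simp only [Complex.add_re, Complex.add_im, Complex.ofReal_re, Complex.ofReal_im]
    linear_combination h2
  have h4 : (i : ℝ) + 1 ≠ 0 := by positivity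
  rw [h1, norm_div, div_pow, h3, Complex.norm_real, Real.norm_eq_abs, sq_abs, drift]
  field_simp; ring

lemma abs_re_le_one (hz : ‖z‖ = 1) : -1 ≤ z.re ∧ z.re ≤ 1 :=
  abs_le.1 (hz ▸ Complex.abs_re_le_norm z)

lemma neg_drift_ge (hz : ‖z‖ = 1) (h : z.re < 1 / 2) (i : ℕ) :
    (1 - 2 * z.re) / 4 ≤ -drift z i := by
  have := (abs_re_le_one hz).1
  rw [drift]
  nlinarith [sq_nonneg (1 / ((i : ℝ) + 1) - (1 - 2 * z.re) / 2)]

lemma exists_drift_ge (hz : ‖z‖ = 1) (h : 1 / 2 < z.re) :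
    ∃ n0 : ℕ, 1 ≤ n0 ∧ ∀ i, n0 ≤ i → (2 * z.re - 1) / 2 ≤ drift z i := by
  have h1 := (abs_re_le_one hz).2
  obtain ⟨n0, hn0⟩ := exists_nat_one_div_lt (show (0 : ℝ) < (2 * z.re - 1) / 4 by linarith)
  refine ⟨n0 + 1, by omega, fun i hi => ?_⟩
  have h2 : 1 / ((i : ℝ) + 1) ≤ 1 / ((n0 : ℝ) + 1) := by
    have : (n0 : ℝ) ≤ i := by exact_mod_cast (by omega : n0 ≤ i)
    gcongr
  have h3 : 0 ≤ 1 / ((i : ℝ) + 1) := by positivity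
  rw [drift]
  nlinarith

lemma tendsto_drift (z : ℂ) : Tendsto (drift z) atTop (𝓝 (2 * z.re - 1)) := by
  have h := tendsto_one_div_add_atTop_nhds_zero_nat (𝕜 := ℝ)
  have := (((h.const_sub 1).const_mul (2 * z.re - 1))).sub (h.pow 2)
  unfold drift
  simpa using this

lemma one_add_div_ne_zero (h : 0 < z.re) (j : ℕ) : 1 + z / ((j : ℂ) + 1) ≠ 0 := by
  intro h0
  have h1 := congrArg Complex.re h0
  have h2 : ((j : ℂ) + 1) = ((j + 1 : ℝ) : ℂ) := by push_cast; rfl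
  rw [h2, Complex.add_re, Complex.div_ofReal_re] at h1
  have : 0 < z.re / ((j : ℝ) + 1) := by positivity
  simp at h1
  linarith

lemma growth_ne_zero (h : 0 < z.re) (i n : ℕ) : growth z i n ≠ 0 :=
  Finset.prod_ne_zero_iff.2 fun j _ => one_add_div_ne_zero h j

/-- `|2 Re z - 1|`-signed drift. -/
def sdrift (z : ℂ) (i : ℕ) : ℝ := if z.re < 1 / 2 then -drift z i else drift z i

lemma tendsto_sdrift (z : ℂ) : Tendsto (sdrift z) atTop (𝓝 |2 * z.re - 1|) := by
  unfold sdrift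
  split_ifs with h
  · rw [abs_of_neg (by linarith)]; exact (tendsto_drift z).neg
  · rw [abs_of_nonneg (by linarith)]; exact tendsto_drift z

lemma backward_step (hz : ‖z‖ = 1) {i n : ℕ} (h : i < n) :
    ((i : ℝ) + 1) * ‖growth z (i + 1) n‖ ^ 2 - i * ‖growth z i n‖ ^ 2
      = -drift z i * ‖growth z (i + 1) n‖ ^ 2 := by
  rw [growth_succ_left z h, norm_mul, mul_pow, ← mul_assoc, norm_one_add_div_sq hz]; ring

lemma forward_step (hz : ‖z‖ = 1) (hre : 0 < z.re) {i n : ℕ} (h : n ≤ i) :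
    (i : ℝ) * ‖(growth z n i)⁻¹‖ ^ 2 - (i + 1) * ‖(growth z n (i + 1))⁻¹‖ ^ 2
      = drift z i * ‖(growth z n (i + 1))⁻¹‖ ^ 2 := by
  have h1 : (growth z n i)⁻¹ = (1 + z / ((i : ℂ) + 1)) * (growth z n (i + 1))⁻¹ := by
    rw [growth_succ_right z h, mul_inv, mul_left_comm, mul_inv_cancel₀ (one_add_div_ne_zero hre i),
      mul_one]
  rw [h1, norm_mul, mul_pow, ← mul_assoc, norm_one_add_div_sq hz]; ring

lemma forward_antitone (hz : ‖z‖ = 1) (hre : 0 < z.re) {n0 n : ℕ} (hn : n0 ≤ n)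
    (hn0 : ∀ i, n0 ≤ i → 0 ≤ drift z i) :
    Antitone fun i : ℕ => ((n + i : ℕ) : ℝ) * ‖(growth z n (n + i))⁻¹‖ ^ 2 := by
  refine antitone_nat_of_succ_le fun i => ?_
  have h1 := forward_step hz hre (n := n) (i := n + i) (by omega)
  have h2 := mul_nonneg (hn0 (n + i) (by omega)) (sq_nonneg ‖(growth z n (n + i + 1))⁻¹‖)
  rw [← add_assoc, Nat.cast_add_one]
  linarith

lemma forward_tendsto (hz : ‖z‖ = 1) (hre : 1 / 2 < z.re) (n : ℕ) :
    Tendsto (fun i : ℕ => (i : ℝ) * ‖(growth z n i)⁻¹‖ ^ 2) atTop (𝓝 0) := by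
  obtain ⟨n0, hn01, hn0⟩ := exists_drift_ge hz hre
  have hle := (abs_re_le_one hz).2
  refine tendsto_zero_of_le_one_sub_div (c := (2 * z.re - 1) / 4) (by linarith)
    (fun i => by positivity) (max n0 n) fun i hi => ?_
  have h1 := forward_step hz (by linarith) (n := n) (i := i) ((le_max_right _ _).trans hi)
  have h2 := hn0 i ((le_max_left _ _).trans hi)
  set X := ‖(growth z n (i + 1))⁻¹‖ ^ 2
  set Y := (i : ℝ) * ‖(growth z n i)⁻¹‖ ^ 2
  have hX : 0 ≤ X := by positivity
  have hi0 : (0 : ℝ) < (i : ℝ) + 1 := by positivity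
  have hY : Y = (i + 1 + drift z i) * X := by linarith
  rw [hY]
  push_cast
  set a := (2 * z.re - 1) / 4 with ha
  have h3 : ((i : ℝ) + 1) ≤ (1 - a / (i + 1)) * (i + 1 + drift z i) := by
    have h5 : a / ((i : ℝ) + 1) ≤ 1 / 4 := by
      rw [div_le_iff₀ hi0]
      have : (0 : ℝ) ≤ i := by positivity
      linarith
    have h6 : a / ((i : ℝ) + 1) * (i + 1) = a := by field_simp
    nlinarith
  calc ((i : ℝ) + 1) * X ≤ ((1 - a / (i + 1)) * (i + 1 + drift z i)) * X :=
        mul_le_mul_of_nonneg_right h3 hX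
    _ = _ := by ring

lemma backward_tendsto (hz : ‖z‖ = 1) (hre : z.re < 1 / 2) (i : ℕ) :
    Tendsto (fun n : ℕ => ‖growth z i n‖ ^ 2 / n) atTop (𝓝 0) := by
  refine tendsto_zero_of_le_one_sub_div (c := (1 - 2 * z.re) / 4) (by linarith)
    (fun i => by positivity) (i + 1) fun n hn => ?_
  rw [growth_succ_right z (by omega), norm_mul, mul_pow]
  have h1 := norm_one_add_div_sq hz n
  have h2 := neg_drift_ge hz hre n
  have hn0 : (0 : ℝ) < n := by exact_mod_cast (by omega : 0 < n)
  have h3 : ‖1 + z / ((n : ℂ) + 1)‖ ^ 2 = (n + 1 + drift z n) / n := by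
    rw [← h1]; field_simp
  rw [h3]
  push_cast
  have h4 : (n + 1 + drift z n) / ((n : ℝ) + 1) ≤ 1 - (1 - 2 * z.re) / 4 / (n + 1) := by
    rw [div_le_iff₀ (by positivity), sub_mul, div_mul_cancel₀ _ (by positivity)]
    linarith
  calc _ = (n + 1 + drift z n) / ((n : ℝ) + 1) * (‖growth z i n‖ ^ 2 / n) := by
        field_simp
    _ ≤ _ := mul_le_mul_of_nonneg_right h4 (by positivity)

/-- Sharp second-order information on the coefficients. -/
lemma coeff_properties (hz : ‖z‖ = 1) (hre : z.re ≠ 1 / 2) : ∃ (n0 : ℕ) (c : ℝ), 1 ≤ n0 ∧ 0 < c ∧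
    ∀ n, n0 ≤ n → (∀ i, ‖coeff z n i‖ ^ 2 ≤ n / (i + 1)) ∧
      (∀ i, c * ‖coeff z n i‖ ^ 2 ≤ sdrift z i * ‖coeff z n i‖ ^ 2) ∧
      HasSum (fun i => sdrift z i * ‖coeff z n i‖ ^ 2) n := by
  rcases lt_or_gt_of_ne hre with h | h
  · refine ⟨1, (1 - 2 * z.re) / 4, le_rfl, by linarith, fun n hn => ?_⟩
    have hd : ∀ i, (1 - 2 * z.re) / 4 ≤ sdrift z i := fun i => by
      rw [sdrift, if_pos h]; exact neg_drift_ge hz h i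
    have hmono : Monotone fun i : ℕ => (i : ℝ) * ‖growth z i n‖ ^ 2 := by
      refine monotone_nat_of_le_succ fun i => ?_
      rcases lt_or_ge i n with hi | hi
      · have h1 := backward_step hz hi
        have h2 := mul_nonneg ((by linarith : 0 ≤ (1 - 2 * z.re) / 4).trans
          (neg_drift_ge hz h i)) (sq_nonneg ‖growth z (i + 1) n‖)
        push_cast; linarith
      · rw [growth_of_le z hi, growth_of_le z (by omega)]; simp
    refine ⟨fun i => ?_, fun i => mul_le_mul_of_nonneg_right (hd i) (sq_nonneg _), ?_⟩
    · rw [coeff, if_pos h]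
      split_ifs with hi
      · have := hmono (show i + 1 ≤ n by omega)
        simp only [growth_self] at this
        push_cast at this
        rw [le_div_iff₀ (by positivity)]
        simp at this
        linarith
      · simp; positivity
    · have hz0 : ∀ i ∉ Finset.range n, sdrift z i * ‖coeff z n i‖ ^ 2 = 0 := by
        intro i hi
        have : ¬ i < n := by simpa using hi
        simp [coeff_of_not_lt h this]
      have h0 : HasSum (fun i => sdrift z i * ‖coeff z n i‖ ^ 2)
          (∑ i ∈ Finset.range n, sdrift z i * ‖coeff z n i‖ ^ 2) :=
        hasSum_sum_of_ne_finset_zero hz0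
      convert h0 using 1
      have h1 : ∀ i ∈ Finset.range n, sdrift z i * ‖coeff z n i‖ ^ 2 =
          ((i + 1 : ℕ) : ℝ) * ‖growth z (i + 1) n‖ ^ 2 - i * ‖growth z i n‖ ^ 2 := by
        intro i hi
        have hi' : i < n := by simpa using hi
        rw [Nat.cast_add_one, backward_step hz hi', sdrift, coeff, if_pos h, if_pos h, if_pos hi']
      rw [Finset.sum_congr rfl h1,
        Finset.sum_range_sub (fun i : ℕ => (i : ℝ) * ‖growth z i n‖ ^ 2) n]
      simp [growth_self]
  · obtain ⟨n0, hn01, hn0⟩ := exists_drift_ge hz h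
    have hnl : ¬ z.re < 1 / 2 := by linarith
    refine ⟨n0, (2 * z.re - 1) / 2, hn01, by linarith, fun n hn => ⟨fun i => ?_, fun i => ?_, ?_⟩⟩
    · rw [coeff, if_neg hnl]
      split_ifs with hi
      · simp; positivity
      · have hanti := forward_antitone hz (by linarith) hn
          (fun i hi => (by linarith : 0 ≤ (2 * z.re - 1) / 2).trans (hn0 i hi))
          (Nat.zero_le (i + 1 - n))
        simp only [add_zero, growth_self] at hanti
        rw [show n + (i + 1 - n) = i + 1 by omega] at hanti
        rw [norm_neg, le_div_iff₀ (by positivity)]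
        push_cast at hanti
        simp only [inv_one, norm_one, one_pow, mul_one] at hanti
        linarith
    · rcases lt_or_ge i n with hi | hi
      · simp [coeff_eq_zero h hi]
      · rw [sdrift, if_neg hnl]
        exact mul_le_mul_of_nonneg_right (hn0 i (by omega)) (sq_nonneg _)
    · rw [← hasSum_nat_add_iff' n]
      have hz0 : ∑ i ∈ Finset.range n, sdrift z i * ‖coeff z n i‖ ^ 2 = 0 := by
        refine Finset.sum_eq_zero fun i hi => ?_
        have : i < n := by simpa using hi
        simp [coeff_eq_zero h this]
      rw [hz0, sub_zero]
      have h1 : ∀ i : ℕ, sdrift z (i + n) * ‖coeff z n (i + n)‖ ^ 2 =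
          ((n + i : ℕ) : ℝ) * ‖(growth z n (n + i))⁻¹‖ ^ 2
            - ((n + (i + 1) : ℕ) : ℝ) * ‖(growth z n (n + (i + 1)))⁻¹‖ ^ 2 := by
        intro i
        have h2 := forward_step hz (by linarith) (n := n) (i := n + i) (by omega)
        rw [← add_assoc n i 1, Nat.cast_add_one, h2, sdrift, if_neg hnl, coeff, if_neg hnl,
          if_neg (by omega), norm_neg, add_comm i n]
      have hnn : ∀ i : ℕ, 0 ≤ sdrift z (i + n) * ‖coeff z n (i + n)‖ ^ 2 := fun i => by
        rw [sdrift, if_neg hnl]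
        exact mul_nonneg ((by linarith : 0 ≤ (2 * z.re - 1) / 2).trans (hn0 _ (by omega)))
          (sq_nonneg _)
      rw [hasSum_iff_tendsto_nat_of_nonneg hnn]
      simp_rw [h1]
      have h3 : ∀ N, ∑ i ∈ Finset.range N, (((n + i : ℕ) : ℝ) * ‖(growth z n (n + i))⁻¹‖ ^ 2
            - ((n + (i + 1) : ℕ) : ℝ) * ‖(growth z n (n + (i + 1)))⁻¹‖ ^ 2) =
            n - ((N + n : ℕ) : ℝ) * ‖(growth z n (N + n))⁻¹‖ ^ 2 := by
        intro N
        rw [Finset.sum_range_sub' (fun i : ℕ => ((n + i : ℕ) : ℝ) *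
          ‖(growth z n (n + i))⁻¹‖ ^ 2) N, add_comm N n]
        simp [growth_self]
      simp_rw [h3]
      have h4 := ((tendsto_add_atTop_iff_nat n).2 (forward_tendsto hz h n)).const_sub (n : ℝ)
      simpa using h4

lemma coeff_tendsto_zero (hz : ‖z‖ = 1) (hre : z.re ≠ 1 / 2) (i : ℕ) :
    Tendsto (fun n : ℕ => ‖coeff z n i‖ ^ 2 / n) atTop (𝓝 0) := by
  rcases lt_or_gt_of_ne hre with h | h
  · refine (backward_tendsto hz h (i + 1)).congr' ?_
    filter_upwards [eventually_gt_atTop i] with n hn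
    rw [coeff_of_lt h hn]
  · refine tendsto_const_nhds.congr' ?_
    filter_upwards [eventually_gt_atTop i] with n hn
    simp [coeff_eq_zero h hn]

lemma coeff_summable (hz : ‖z‖ = 1) (hre : z.re ≠ 1 / 2) : ∃ C : ℝ, ∀ᶠ n : ℕ in atTop,
    Summable (fun i => ‖coeff z n i‖ ^ 2 / n) ∧ ∑' i, ‖coeff z n i‖ ^ 2 / n ≤ C := by
  obtain ⟨n0, c, hn01, hc, h⟩ := coeff_properties hz hre
  refine ⟨1 / c, ?_⟩
  filter_upwards [eventually_ge_atTop n0] with n hn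
  obtain ⟨-, h2, h3⟩ := h n hn
  have hn' : (0 : ℝ) < n := by exact_mod_cast (by omega : 0 < n)
  have h4 : ∀ i, ‖coeff z n i‖ ^ 2 / n ≤ (1 / (c * n)) * (sdrift z i * ‖coeff z n i‖ ^ 2) := by
    intro i
    rw [div_mul_eq_mul_div, one_mul, div_le_div_iff₀ hn' (by positivity)]
    have := mul_le_mul_of_nonneg_right (h2 i) hn'.le
    linarith
  have h5 := h3.mul_left (1 / (c * n))
  have h6 : Summable (fun i => ‖coeff z n i‖ ^ 2 / n) :=
    Summable.of_nonneg_of_le (fun i => by positivity) h4 h5.summable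
  refine ⟨h6, (h6.tsum_le_tsum h4 h5.summable).trans (le_of_eq ?_)⟩
  rw [h5.tsum_eq]; field_simp

lemma coeff_tsum_tendsto (hz : ‖z‖ = 1) (hre : z.re ≠ 1 / 2) :
    Tendsto (fun n : ℕ => ∑' i, ‖coeff z n i‖ ^ 2 / n) atTop (𝓝 |2 * z.re - 1|⁻¹) := by
  obtain ⟨C, hC⟩ := coeff_summable hz hre
  obtain ⟨n0, c, hn01, hc, h⟩ := coeff_properties hz hre
  have ha : |2 * z.re - 1| ≠ 0 := by
    rw [abs_ne_zero]; intro h; apply hre; linarith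
  have h1 := tendsto_tsum_mul_zero (fun n i => (by positivity : 0 ≤ ‖coeff z n i‖ ^ 2 / (n : ℝ))) hC
    (coeff_tendsto_zero hz hre)
    (δ := fun i => |2 * z.re - 1| - sdrift z i)
    (by simpa using (tendsto_sdrift z).const_sub |2 * z.re - 1|)
  have h2 := (h1.add_const 1).const_mul |2 * z.re - 1|⁻¹
  rw [zero_add, mul_one] at h2
  refine h2.congr' ?_
  filter_upwards [hC, eventually_ge_atTop n0] with n hn hn'
  have hn'' : (n : ℝ) ≠ 0 := by exact_mod_cast (by omega : n ≠ 0)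
  have h3 := (h n hn').2.2.div_const (n : ℝ)
  rw [div_self hn''] at h3
  have h4 := hn.1.hasSum.mul_right |2 * z.re - 1|
  have h5 := h4.sub h3
  have h6 : (fun i => ‖coeff z n i‖ ^ 2 / (n : ℝ) * (|2 * z.re - 1| - sdrift z i)) =
      fun i => ‖coeff z n i‖ ^ 2 / (n : ℝ) * |2 * z.re - 1| -
        sdrift z i * ‖coeff z n i‖ ^ 2 / n := by
    ext i; ring
  rw [h6, h5.tsum_eq, sub_add_cancel, mul_comm, mul_assoc, mul_inv_cancel₀ ha, mul_one]

end Weights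

section Equidistribution

lemma cw_pow_ne_one {m k : ℕ} (hm : 2 ≤ m) (hk : k ∈ Finset.Icc 1 (m - 1)) : cw m ^ k ≠ 1 := by
  rw [Finset.mem_Icc] at hk
  exact (isPrimitiveRoot_cw (by omega)).pow_ne_one_of_pos_of_lt (by omega) (by omega)

lemma lam_lt_one {m k : ℕ} (hm : 2 ≤ m) (hk : k ∈ Finset.Icc 1 (m - 1)) : lam m k < 1 := by
  have h := norm_cw_pow m k
  have h1 : (cw m ^ k).re ^ 2 + (cw m ^ k).im ^ 2 = 1 := by
    rw [← one_pow (M := ℝ) 2, ← h, ← Complex.normSq_eq_norm_sq, Complex.normSq_apply]; ring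
  rw [← cw_pow_re]
  refine lt_of_le_of_ne (h ▸ Complex.re_le_norm _) fun h2 => cw_pow_ne_one hm hk ?_
  rw [h2] at h1
  refine Complex.ext h2 ?_
  simpa using h1

lemma tendsto_div_sq_of_recursion {U : ℕ → ℝ} {l : ℝ} (hU : ∀ n, 0 ≤ U n) (hl : l < 1)
    (h : ∀ n : ℕ, U (n + 1) = (1 + 2 * l / (n + 1)) * U n + 1) :
    Tendsto (fun n : ℕ => U n / ((n : ℝ) + 1) ^ 2) atTop (𝓝 0) := by
  obtain ⟨ρ, hρ1, hρ2, hρ3⟩ : ∃ ρ : ℝ, 2 * l ≤ ρ ∧ 3 / 2 ≤ ρ ∧ ρ < 2 :=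
    ⟨max (2 * l) (3 / 2), le_max_left _ _, le_max_right _ _,
      max_lt (by linarith) (by norm_num)⟩
  have hρ0 : 0 < ρ - 1 := by linarith
  have hlim : Tendsto (fun n : ℕ => (U n + ((n : ℝ) + 1) / (ρ - 1)) / ((n : ℝ) + 1) ^ 2) atTop
      (𝓝 0) := by
    refine tendsto_zero_of_le_one_sub_div (c := (2 - ρ) / 2) (by linarith)
      (fun n => div_nonneg (add_nonneg (hU n) (by positivity)) (by positivity)) 0 fun n _ => ?_
    set V := U n + ((n : ℝ) + 1) / (ρ - 1) with hV
    have hV0 : 0 ≤ V := add_nonneg (hU n) (by positivity)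
    have hn : (0 : ℝ) < (n : ℝ) + 1 := by positivity
    have h1 : U (n + 1) + (((n + 1 : ℕ) : ℝ) + 1) / (ρ - 1) ≤ (1 + ρ / (n + 1)) * V := by
      have h2 : (1 + ρ / ((n : ℝ) + 1)) * V = (1 + ρ / ((n : ℝ) + 1)) * U n +
          (1 + (((n + 1 : ℕ) : ℝ) + 1) / (ρ - 1)) := by
        rw [hV]; push_cast; field_simp; ring
      rw [h2, h]
      have h3 : (1 + 2 * l / ((n : ℝ) + 1)) * U n ≤ (1 + ρ / ((n : ℝ) + 1)) * U n := by
        refine mul_le_mul_of_nonneg_right ?_ (hU n)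
        gcongr
      linarith
    refine (div_le_div_of_nonneg_right h1 (by positivity)).trans ?_
    have h4 : (1 + ρ / ((n : ℝ) + 1)) / (((n + 1 : ℕ) : ℝ) + 1) ^ 2 ≤
        (1 - (2 - ρ) / 2 / (n + 1)) / ((n : ℝ) + 1) ^ 2 := by
      push_cast
      have hn1 : (1 : ℝ) ≤ (n : ℝ) + 1 := by linarith [(Nat.cast_nonneg n : (0 : ℝ) ≤ n)]
      generalize (n : ℝ) + 1 = x at *
      rw [div_le_div_iff₀ (by positivity) (by positivity)]
      have e1 : (1 + ρ / x) * x ^ 2 = (x + ρ) * x := by field_simp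
      have e2 : (1 - (2 - ρ) / 2 / x) * (x + 1) ^ 2 =
          (x - (2 - ρ) / 2) * (x + 1) ^ 2 / x := by field_simp
      rw [e1, e2, le_div_iff₀ hn]
      nlinarith [mul_nonneg (sub_nonneg.2 hn1) hn.le, mul_pos hn hn]
    calc _ = (1 + ρ / ((n : ℝ) + 1)) / (((n + 1 : ℕ) : ℝ) + 1) ^ 2 * V := by ring
      _ ≤ (1 - (2 - ρ) / 2 / (n + 1)) / ((n : ℝ) + 1) ^ 2 * V :=
        mul_le_mul_of_nonneg_right h4 hV0
      _ = _ := by ring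
  refine squeeze_zero (fun n => div_nonneg (hU n) (by positivity)) (fun n => ?_) hlim
  gcongr
  have : 0 ≤ ((n : ℝ) + 1) / (ρ - 1) := by positivity
  linarith

lemma integral_le_sqrt_integral_sq {Ω : Type*} [MeasurableSpace Ω] {μ : Measure Ω}
    [IsProbabilityMeasure μ] {f : Ω → ℝ} (hf : Integrable f μ)
    (hf2 : Integrable (fun ω => f ω ^ 2) μ) : ∫ ω, f ω ∂μ ≤ √(∫ ω, f ω ^ 2 ∂μ) := by
  refine Real.le_sqrt_of_sq_le ?_
  set c := ∫ ω, f ω ∂μ with hc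
  have h1 : ∫ ω, (f ω - c) ^ 2 ∂μ = ∫ ω, f ω ^ 2 ∂μ - c ^ 2 := by
    have : (fun ω => (f ω - c) ^ 2) = fun ω => (f ω ^ 2 - 2 * c * f ω) + c ^ 2 := by
      ext ω; ring
    have hi : Integrable (fun ω => 2 * c * f ω) μ := hf.const_mul _
    have hs : Integrable (fun ω => f ω ^ 2 - 2 * c * f ω) μ := hf2.sub hi
    rw [this, integral_add hs (integrable_const _), integral_sub hf2 hi,
      integral_const_mul, ← hc]
    simp; ring
  have h2 : 0 ≤ ∫ ω, (f ω - c) ^ 2 ∂μ := integral_nonneg fun ω => sq_nonneg _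
  linarith

lemma sum_range_eq_add_Icc {M : Type*} [AddCommMonoid M] {m : ℕ} (hm : 1 ≤ m) (f : ℕ → M) :
    ∑ k ∈ Finset.range m, f k = f 0 + ∑ k ∈ Finset.Icc 1 (m - 1), f k := by
  have : Finset.range m = insert 0 (Finset.Icc 1 (m - 1)) := by
    ext a; simp; omega
  rw [this, Finset.sum_insert (by simp)]

variable {Ω : Type*} [MeasurableSpace Ω] {μ : Measure Ω} {m : ℕ} {j0 : Fin m}
  {R : ℕ → Ω → Fin m → ℝ}

namespace IsCyclicUrn

lemma integrable_norm_ucoef_sq (hm : 2 ≤ m) (hR : IsCyclicUrn μ m j0 R) (n k : ℕ) :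
    Integrable (fun ω => ‖ucoef m k (R n ω)‖ ^ 2) μ := by
  have := hR.isProb
  refine Integrable.of_bound (C := ((n : ℝ) + 1) ^ 2)
    ((hR.measurable_ucoef n k).norm.pow_const 2).aestronglyMeasurable ?_
  filter_upwards [hR.ae_norm_ucoef_le hm n k] with ω h
  rw [norm_pow, norm_norm]
  gcongr

lemma tendsto_meanDev (hm : 2 ≤ m) (hR : IsCyclicUrn μ m j0 R) :
    Tendsto (meanDev μ R) atTop (𝓝 0) := by
  have := hR.isProb
  have hle : ∀ n, meanDev μ R n ≤ ∑ k ∈ Finset.Icc 1 (m - 1),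
      √((∫ ω, ‖ucoef m k (R n ω)‖ ^ 2 ∂μ) / ((n : ℝ) + 1) ^ 2) := by
    intro n
    have hn : (0 : ℝ) < (n : ℝ) + 1 := by positivity
    have h1 : meanDev μ R n ≤
        ∫ ω, ∑ k ∈ Finset.Icc 1 (m - 1), ‖ucoef m k (R n ω)‖ / ((n : ℝ) + 1) ∂μ := by
      refine integral_mono_ae (hR.integrable_dev n) (integrable_finsetSum _ fun k _ =>
        (hR.integrable_ucoef hm n k).norm.div_const _) ?_
      filter_upwards [hR.ae_sum hm n] with ω h
      have h2 : ∀ j : Fin m, |R n ω j / ((n : ℝ) + 1) - 1 / m| ≤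
          (m : ℝ)⁻¹ * ∑ k ∈ Finset.Icc 1 (m - 1), ‖ucoef m k (R n ω)‖ / ((n : ℝ) + 1) := by
        intro j
        have h3 := sum_ucoef_mul_vvec (R n ω) j
        rw [sum_range_eq_add_Icc (by omega), ucoef_zero, vvec_zero, ← Complex.ofReal_sum, h] at h3
        have h4 : ((R n ω j / ((n : ℝ) + 1) - 1 / m : ℝ) : ℂ) =
            (∑ k ∈ Finset.Icc 1 (m - 1), ucoef m k (R n ω) * vvec m k j) / ((n + 1 : ℝ) : ℂ) := by
          have hn' : ((n + 1 : ℝ) : ℂ) ≠ 0 := by exact_mod_cast hn.ne'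
          rw [Complex.ofReal_sub, Complex.ofReal_div, ← h3]
          push_cast at hn' ⊢
          field_simp
          ring
        rw [← Real.norm_eq_abs, ← Complex.norm_real, h4, norm_div, Complex.norm_real,
          Real.norm_eq_abs, abs_of_pos hn, ← Finset.sum_div, mul_div_assoc']
        gcongr
        refine (norm_sum_le _ _).trans (le_of_eq ?_)
        rw [Finset.mul_sum]
        refine Finset.sum_congr rfl fun k _ => ?_
        rw [norm_mul, norm_vvec, mul_comm]
      refine (Finset.sum_le_sum fun j _ => h2 j).trans (le_of_eq ?_)
      have hm0 : (m : ℝ) ≠ 0 := by positivity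
      rw [Finset.sum_const, Finset.card_univ, Fintype.card_fin, nsmul_eq_mul, ← mul_assoc,
        mul_inv_cancel₀ hm0, one_mul]
    rw [integral_finsetSum _ fun k _ => (hR.integrable_ucoef hm n k).norm.div_const _] at h1
    refine h1.trans (Finset.sum_le_sum fun k _ => ?_)
    rw [integral_div, Real.sqrt_div' _ (by positivity), Real.sqrt_sq hn.le]
    exact div_le_div_of_nonneg_right (integral_le_sqrt_integral_sq
      (hR.integrable_ucoef hm n k).norm (hR.integrable_norm_ucoef_sq hm n k)) hn.le
  refine squeeze_zero (fun n => integral_nonneg fun ω => Finset.sum_nonneg fun _ _ => abs_nonneg _)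
    hle ?_
  rw [← Finset.sum_const_zero (s := Finset.Icc 1 (m - 1))]
  refine tendsto_finsetSum _ fun k hk => ?_
  rw [← Real.sqrt_zero]
  exact (tendsto_div_sq_of_recursion (fun n => integral_nonneg fun ω => sq_nonneg _)
    (lam_lt_one hm hk) (fun n => hR.integral_norm_ucoef_sq_succ hm n k)).sqrt

end IsCyclicUrn

end Equidistribution

section GrowthAsymptotics

variable {z : ℂ}

lemma norm_step_sub_one_le (hz : ‖z‖ = 1) (hre : 0 < z.re) {t : ℝ} (ht0 : 0 ≤ t) (ht : t ≤ 1 / 2) :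
    ‖(1 + z * t) * Complex.exp (z * (Real.log (1 - t) : ℝ)) - 1‖ ≤ 4 * t ^ 2 := by
  set f : ℝ → ℂ := fun s => (1 + z * s) * Complex.exp (z * (Real.log (1 - s) : ℝ)) with hf
  have hd : ∀ s ∈ Set.Icc 0 t, HasDerivWithinAt f
      (z * Complex.exp (z * (Real.log (1 - s) : ℝ)) + (1 + z * s) *
        (Complex.exp (z * (Real.log (1 - s) : ℝ)) * (z * ((-1 / (1 - s) : ℝ) : ℂ))))
      (Set.Icc 0 t) s := by
    intro s hs
    have hs1 : 1 - s ≠ 0 := by have := hs.2; linarith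
    have h1 : HasDerivAt (fun s : ℝ => Real.log (1 - s)) (-1 / (1 - s)) s :=
      ((hasDerivAt_id s).const_sub 1).log hs1
    have h2 := (h1.ofReal_comp.const_mul z).cexp
    have h3 : HasDerivAt (fun s : ℝ => 1 + z * (s : ℂ)) z s := by
      simpa using ((hasDerivAt_id s).ofReal_comp.const_mul z).const_add 1
    exact (h3.mul h2).hasDerivWithinAt
  have hb : ∀ s ∈ Set.Icc 0 t, ‖z * Complex.exp (z * (Real.log (1 - s) : ℝ)) + (1 + z * s) *
        (Complex.exp (z * (Real.log (1 - s) : ℝ)) * (z * ((-1 / (1 - s) : ℝ) : ℂ)))‖ ≤ 4 * t := by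
    intro s hs
    have hs1 : 0 < 1 - s := by have := hs.2; linarith
    have hs1' : (1 - (s : ℂ)) ≠ 0 := by exact_mod_cast hs1.ne'
    have e : z * Complex.exp (z * (Real.log (1 - s) : ℝ)) + (1 + z * s) *
        (Complex.exp (z * (Real.log (1 - s) : ℝ)) * (z * ((-1 / (1 - s) : ℝ) : ℂ))) =
        Complex.exp (z * (Real.log (1 - s) : ℝ)) * z * (-(1 + z)) * ((s / (1 - s) : ℝ) : ℂ) := by
      push_cast; field_simp; ring
    have h1 : ‖Complex.exp (z * (Real.log (1 - s) : ℝ))‖ ≤ 1 := by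
      rw [Complex.norm_exp, Complex.re_mul_ofReal, Real.exp_le_one_iff]
      exact mul_nonpos_of_nonneg_of_nonpos hre.le
        (Real.log_nonpos hs1.le (by have := hs.1; linarith))
    have h2 : ‖-(1 + z)‖ ≤ 2 := by
      rw [norm_neg]; refine (norm_add_le _ _).trans ?_
      rw [hz, norm_one]; norm_num
    have h3 : ‖((s / (1 - s) : ℝ) : ℂ)‖ ≤ 2 * t := by
      rw [Complex.norm_real, Real.norm_eq_abs, abs_of_nonneg (div_nonneg hs.1 hs1.le),
        div_le_iff₀ hs1]
      have := hs.1; have := hs.2; nlinarith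
    rw [e, norm_mul, norm_mul, norm_mul, hz, mul_one]
    calc _ ≤ 1 * 2 * (2 * t) := by gcongr
      _ = _ := by ring
  have h := (convex_Icc (0 : ℝ) t).norm_image_sub_le_of_norm_hasDerivWithin_le hd hb
    (Set.left_mem_Icc.2 ht0) (Set.right_mem_Icc.2 ht0)
  have hf0 : f 0 = 1 := by simp [hf]
  rw [hf0, sub_zero, Real.norm_eq_abs, abs_of_nonneg ht0] at h
  calc _ ≤ 4 * t * t := h
    _ = _ := by ring

lemma growth_mul_GammaSeq (hre : 0 < z.re) (n : ℕ) :
    growth z 0 n * (z * Complex.GammaSeq z n) = (n : ℂ) ^ z := by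
  have hz : z ≠ 0 := fun h => by simp [h] at hre
  have h1 : growth z 0 n * (n.factorial : ℂ) = ∏ j ∈ Finset.range n, (z + ((j + 1 : ℕ) : ℂ)) := by
    rw [growth, ← Finset.prod_range_add_one_eq_factorial, Nat.cast_prod, ← Finset.range_eq_Ico,
      ← Finset.prod_mul_distrib]
    refine Finset.prod_congr rfl fun j _ => ?_
    have : (j : ℂ) + 1 ≠ 0 := by exact_mod_cast Nat.succ_ne_zero j
    push_cast; field_simp; ring
  have h2 : ∏ j ∈ Finset.range n, (z + ((j + 1 : ℕ) : ℂ)) ≠ 0 := by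
    rw [← h1]
    exact mul_ne_zero (growth_ne_zero hre 0 n) (by exact_mod_cast n.factorial_ne_zero)
  rw [Complex.GammaSeq, Finset.prod_range_succ', ← h1]
  rw [← h1] at h2
  have h3 := left_ne_zero_of_mul h2
  have h4 := right_ne_zero_of_mul h2
  simp only [Nat.cast_zero, add_zero]
  field_simp

/-- The products `growth z 0 n` are asymptotic to a multiple of `n ^ z` up to bounded error. -/
lemma growth_asymptotic (hz : ‖z‖ = 1) (hre : 0 < z.re) :
    ∃ (c : ℂ) (C : ℝ), ∀ n : ℕ, 1 ≤ n → ‖growth z 0 n - (n : ℂ) ^ z * c‖ ≤ C := by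
  have hz0 : z ≠ 0 := fun h => by simp [h] at hre
  set q : ℕ → ℂ := fun n => (z * Complex.GammaSeq z n)⁻¹ with hq
  have hG : z * Complex.Gamma z ≠ 0 := mul_ne_zero hz0 (Complex.Gamma_ne_zero_of_re_pos hre)
  have hlim : Tendsto q atTop (𝓝 (z * Complex.Gamma z)⁻¹) :=
    ((Complex.GammaSeq_tendsto_Gamma z).const_mul z).inv₀ hG
  obtain ⟨B, hB⟩ : ∃ B, ∀ i, ‖q i‖ ≤ B := by
    obtain ⟨B, hB⟩ := (Metric.isBounded_range_of_tendsto q hlim).exists_norm_le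
    exact ⟨B, fun i => hB _ ⟨i, rfl⟩⟩
  have hB0 : 0 ≤ B := (norm_nonneg _).trans (hB 0)
  have hgq : ∀ n : ℕ, 1 ≤ n → growth z 0 n = (n : ℂ) ^ z * q n := by
    intro n hn
    have h1 := growth_mul_GammaSeq hre n
    have h2 : (n : ℂ) ^ z ≠ 0 := by
      rw [Complex.cpow_ne_zero_iff]; left; exact_mod_cast (by omega : n ≠ 0)
    rw [hq, ← h1]
    have h3 : z * Complex.GammaSeq z n ≠ 0 := by
      intro h; rw [h, mul_zero] at h1; exact h2 h1.symm
    rw [mul_assoc, mul_inv_cancel₀ h3, mul_one]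
  have hstep : ∀ n : ℕ, 1 ≤ n → ‖q (n + 1) - q n‖ ≤ 4 * B / n - 4 * B / ((n + 1 : ℕ) : ℝ) := by
    intro n hn
    have hn0 : (0 : ℝ) < n := by exact_mod_cast hn
    set t : ℝ := 1 / ((n : ℝ) + 1) with ht
    have ht0 : 0 ≤ t := by positivity
    have ht1 : t ≤ 1 / 2 := by
      rw [ht]; have : (1 : ℝ) ≤ n := by exact_mod_cast hn
      gcongr; linarith
    have h1 : q (n + 1) = q n * ((1 + z * t) * Complex.exp (z * (Real.log (1 - t) : ℝ))) := by
      have e1 := growth_succ_right z (Nat.zero_le n)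
      rw [hgq n hn, hgq (n + 1) (by omega)] at e1
      have e2 : (n : ℂ) ^ z = ((n + 1 : ℕ) : ℂ) ^ z *
          Complex.exp (z * (Real.log (1 - t) : ℝ)) := by
        have e3 : 1 - t = n / ((n + 1 : ℕ) : ℝ) := by rw [ht]; push_cast; field_simp; ring
        rw [e3, Real.log_div hn0.ne' (by positivity),
          Complex.cpow_def_of_ne_zero (by exact_mod_cast hn0.ne'),
          Complex.cpow_def_of_ne_zero (by exact_mod_cast Nat.succ_ne_zero n), ← Complex.exp_add,
          ← Complex.natCast_log, ← Complex.natCast_log]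
        congr 1; push_cast; ring
      have e4 : ((n + 1 : ℕ) : ℂ) ^ z ≠ 0 := by
        rw [Complex.cpow_ne_zero_iff]; left; exact_mod_cast Nat.succ_ne_zero n
      have e5 : z / ((n : ℂ) + 1) = z * t := by rw [ht]; push_cast; ring
      rw [e2, e5] at e1
      refine mul_left_cancel₀ e4 ?_
      rw [e1]; ring
    have h2 : q (n + 1) - q n =
        q n * ((1 + z * t) * Complex.exp (z * (Real.log (1 - t) : ℝ)) - 1) := by
      rw [h1]; ring
    rw [h2, norm_mul]
    calc _ ≤ B * (4 * t ^ 2) :=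
          mul_le_mul (hB n) (norm_step_sub_one_le hz hre ht0 ht1) (norm_nonneg _) hB0
      _ ≤ _ := by
        have e : 4 * B / n - 4 * B / ((n + 1 : ℕ) : ℝ) = B * (4 * (t * (1 / n))) := by
          rw [ht]; push_cast; field_simp; ring
        rw [e, sq]
        gcongr
        rw [ht]; gcongr; linarith
  have hN : ∀ n N : ℕ, 1 ≤ n → n ≤ N → ‖q N - q n‖ ≤ 4 * B / n - 4 * B / N := by
    intro n N hn hN
    induction N, hN using Nat.le_induction with
    | base => simp
    | succ N hN ih =>
      have h1 := hstep N (hn.trans hN)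
      have h2 : q (N + 1) - q n = (q (N + 1) - q N) + (q N - q n) := by ring
      rw [h2]
      refine (norm_add_le _ _).trans ?_
      linarith
  refine ⟨(z * Complex.Gamma z)⁻¹, 4 * B, fun n hn => ?_⟩
  have hn0 : (0 : ℝ) < n := by exact_mod_cast hn
  have h1 : ‖(z * Complex.Gamma z)⁻¹ - q n‖ ≤ 4 * B / n := by
    refine le_of_tendsto (hlim.sub_const (q n)).norm ?_
    filter_upwards [eventually_ge_atTop n] with N hnN
    have : 0 ≤ 4 * B / (N : ℝ) := by positivity
    linarith [hN n N hn hnN]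
  rw [hgq n hn, ← mul_sub, norm_mul, norm_sub_rev, Complex.norm_natCast_cpow_of_pos (by omega)]
  have h2 : (n : ℝ) ^ z.re ≤ n := by
    have : (n : ℝ) ^ z.re ≤ (n : ℝ) ^ (1 : ℝ) :=
      Real.rpow_le_rpow_of_exponent_le (by exact_mod_cast hn) (abs_re_le_one hz).2
    simpa using this
  calc _ ≤ (n : ℝ) * (4 * B / n) := mul_le_mul h2 h1 (norm_nonneg _) hn0.le
    _ = _ := by field_simp

end GrowthAsymptotics

section Fluctuations

lemma exists_L1_limit {Ω : Type*} [MeasurableSpace Ω] {μ : Measure Ω} {f : ℕ → Ω → ℂ}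
    (hf : ∀ n, Integrable (f n) μ) {b : ℕ → ℝ} (hb : Tendsto b atTop (𝓝 0))
    (h : ∀ n N, n ≤ N → ∫ ω, ‖f N ω - f n ω‖ ∂μ ≤ b n) :
    ∃ Z : Ω → ℂ, Integrable Z μ ∧ Tendsto (fun n => ∫ ω, ‖f n ω - Z ω‖ ∂μ) atTop (𝓝 0) := by
  have hdist : ∀ {f g : Ω → ℂ} (hf : Integrable f μ) (hg : Integrable g μ),
      dist (hf.toL1 f) (hg.toL1 g) = ∫ ω, ‖f ω - g ω‖ ∂μ := by
    intro f g hf hg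
    rw [dist_eq_norm, ← Integrable.toL1_sub, L1.norm_of_fun_eq_integral_norm]
    rfl
  have hc : CauchySeq fun n => (hf n).toL1 (f n) := by
    refine cauchySeq_of_le_tendsto_0' b (fun n N hnN => ?_) hb
    rw [dist_comm, hdist]
    exact h n N hnN
  obtain ⟨F, hF⟩ := cauchySeq_tendsto_of_complete hc
  refine ⟨F, L1.integrable_coeFn F, ?_⟩
  have h1 := tendsto_iff_dist_tendsto_zero.1 hF
  refine h1.congr fun n => ?_
  rw [← hdist (hf n) (L1.integrable_coeFn F), Integrable.toL1_coeFn]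

/-- The coefficient of the centred composition along the `k`-th eigendirection. -/
def fluct {Ω : Type*} [MeasurableSpace Ω] (μ : Measure Ω) (m k : ℕ) (R : ℕ → Ω → Fin m → ℝ)
    (n : ℕ) (ω : Ω) : ℂ := ucoef m k (fun t => R n ω t - expVec μ (R n) t)

/-- The martingale increment along the `k`-th eigendirection. -/
def urnInc {Ω : Type*} (m k : ℕ) (R : ℕ → Ω → Fin m → ℝ) (n : ℕ) (ω : Ω) : ℂ :=
  ucoef m k (R (n + 1) ω) - (1 + cw m ^ k / (n + 1)) * ucoef m k (R n ω)

variable {Ω : Type*} [MeasurableSpace Ω] {μ : Measure Ω} {m : ℕ} {j0 : Fin m}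
  {R : ℕ → Ω → Fin m → ℝ}

lemma urnInc_drawSet (hm : 2 ≤ m) {n : ℕ} {j : Fin m} {ω : Ω} (h : ω ∈ drawSet m R n j) (k : ℕ) :
    urnInc m k R n ω = cw m ^ (k * ((j : ℕ) + 1)) - cw m ^ k / (n + 1) * ucoef m k (R n ω) := by
  rw [urnInc, IsCyclicUrn.ucoef_drawSet hm h k]; ring

namespace IsCyclicUrn

lemma fluct_eq (hR : IsCyclicUrn μ m j0 R) (k n : ℕ) (ω : Ω) :
    fluct μ m k R n ω = ucoef m k (R n ω) - ∫ ω, ucoef m k (R n ω) ∂μ := by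
  rw [hR.integral_ucoef_eq, ← ucoef_sub]; rfl

lemma fluct_zero (hR : IsCyclicUrn μ m j0 R) (k : ℕ) (ω : Ω) :
    fluct μ m k R 0 ω = 0 := by
  have := hR.isProb
  rw [hR.fluct_eq]
  simp [hR.init]

lemma fluct_succ (hm : 2 ≤ m) (hR : IsCyclicUrn μ m j0 R) (k n : ℕ) (ω : Ω) :
    fluct μ m k R (n + 1) ω =
      (1 + cw m ^ k / (n + 1)) * fluct μ m k R n ω + urnInc m k R n ω := by
  rw [hR.fluct_eq, hR.fluct_eq, hR.integral_ucoef_succ hm, urnInc]; ring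

lemma fluct_eq_sum (hm : 2 ≤ m) (hR : IsCyclicUrn μ m j0 R) (k n : ℕ) (ω : Ω) :
    fluct μ m k R n ω =
      ∑ i ∈ Finset.range n, growth (cw m ^ k) (i + 1) n * urnInc m k R i ω := by
  induction n with
  | zero => simp [hR.fluct_zero]
  | succ n ih =>
    rw [hR.fluct_succ hm, ih, Finset.sum_range_succ, growth_self, one_mul, Finset.mul_sum]
    congr 1
    refine Finset.sum_congr rfl fun i hi => ?_
    rw [growth_succ_right _ (by simp at hi; omega)]; ring

lemma measurable_fluct (k n : ℕ) :
    Measurable[urnFilt m R n] (fluct μ m k R n) := by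
  refine (continuous_ucoef m k).measurable.comp ?_
  exact (measurable_urnFilt le_rfl).sub_const _

lemma integrable_fluct (hm : 2 ≤ m) (hR : IsCyclicUrn μ m j0 R) (k n : ℕ) :
    Integrable (fluct μ m k R n) μ := by
  have := hR.isProb
  refine ((hR.integrable_ucoef hm n k).sub
    (integrable_const (∫ ω, ucoef m k (R n ω) ∂μ))).congr (ae_of_all _ fun ω => ?_)
  exact (hR.fluct_eq k n ω).symm

lemma ae_norm_fluct_le (hm : 2 ≤ m) (hR : IsCyclicUrn μ m j0 R) (k n : ℕ) :
    ∀ᵐ ω ∂μ, ‖fluct μ m k R n ω‖ ≤ 2 * (n + 1) := by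
  have := hR.isProb
  have h1 : ‖∫ ω, ucoef m k (R n ω) ∂μ‖ ≤ n + 1 := by
    simpa using norm_integral_le_of_norm_le_const (hR.ae_norm_ucoef_le hm n k)
  filter_upwards [hR.ae_norm_ucoef_le hm n k] with ω h
  rw [hR.fluct_eq]
  refine (norm_sub_le _ _).trans ?_
  linarith

lemma measurable_urnInc (k i : ℕ) :
    Measurable[urnFilt m R (i + 1)] (urnInc m k R i) := by
  refine Measurable.sub ?_ (Measurable.const_mul ?_ _)
  · exact (stronglyMeasurable_ucoef k le_rfl).measurable
  · exact (stronglyMeasurable_ucoef k (Nat.le_succ i)).measurable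

/-- Orthogonality of a martingale increment to the past. -/
lemma integral_norm_add_urnInc_sq_le (hm : 2 ≤ m) (hR : IsCyclicUrn μ m j0 R) (k n : ℕ) (w : ℂ)
    {F : Ω → ℂ} (hF : Measurable[urnFilt m R n] F) {C : ℝ} (hC : ∀ᵐ ω ∂μ, ‖F ω‖ ≤ C) :
    ∫ ω, ‖F ω + w * urnInc m k R n ω‖ ^ 2 ∂μ ≤ ∫ ω, ‖F ω‖ ^ 2 ∂μ + 4 * ‖w‖ ^ 2 := by
  have := hR.isProb
  let d : Fin m → Ω → ℂ := fun j ω =>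
    w * (cw m ^ (k * ((j : ℕ) + 1)) - cw m ^ k / (n + 1) * ucoef m k (R n ω))
  have hd : ∀ᵐ ω ∂μ, ∀ j, ‖d j ω‖ ≤ 2 * ‖w‖ := by
    filter_upwards [hR.ae_norm_ucoef_le hm n k] with ω h j
    rw [norm_mul, mul_comm]
    gcongr
    refine (norm_sub_le _ _).trans ?_
    have hn : ‖(n : ℂ) + 1‖ = (n : ℝ) + 1 := by
      rw [← Nat.cast_add_one, Complex.norm_natCast]; push_cast; rfl
    rw [norm_mul, norm_div, norm_cw_pow, norm_cw_pow, hn]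
    have : 1 / ((n : ℝ) + 1) * ‖ucoef m k (R n ω)‖ ≤ 1 := by
      rw [one_div, inv_mul_le_iff₀ (by positivity)]; linarith
    linarith
  have hm' : ∀ j, Measurable[urnFilt m R n] fun ω => ‖F ω + d j ω‖ ^ 2 := fun j =>
    ((hF.stronglyMeasurable.add ((stronglyMeasurable_const.sub
      ((stronglyMeasurable_ucoef k le_rfl).const_mul _)).const_mul w)).norm.pow 2).measurable
  have hFi : Integrable (fun ω => ‖F ω‖ ^ 2) μ := by
    refine Integrable.of_bound (C := C ^ 2)
      ((hF.stronglyMeasurable.norm.pow 2).measurable.mono (hR.urnFilt_le n) le_rfl).aestronglyMeasurable ?_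
    filter_upwards [hC] with ω h
    rw [norm_pow, norm_norm]; gcongr
  have hGi : ∀ j, Integrable (fun ω => ‖F ω + d j ω‖ ^ 2) μ := fun j => by
    refine Integrable.of_bound (C := (C + 2 * ‖w‖) ^ 2)
      ((hm' j).mono (hR.urnFilt_le n) le_rfl).aestronglyMeasurable ?_
    filter_upwards [hC, hd] with ω h h'
    rw [norm_pow, norm_norm]
    gcongr
    exact (norm_add_le _ _).trans (add_le_add h (h' j))
  rw [hR.integral_step_real hm n (fun j ω => ‖F ω + d j ω‖ ^ 2)
    (fun j => (hm' j).stronglyMeasurable) hGi _ (fun j ω h => by rw [urnInc_drawSet hm h k])]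
  have h4 : ∫ ω, ‖F ω‖ ^ 2 ∂μ + 4 * ‖w‖ ^ 2 = ∫ ω, (‖F ω‖ ^ 2 + 4 * ‖w‖ ^ 2) ∂μ := by
    rw [integral_add hFi (integrable_const _)]; simp
  rw [h4]
  refine integral_mono_of_nonneg (ae_of_all _ fun ω => Finset.sum_nonneg fun j _ =>
    mul_nonneg (div_nonneg (hR.nonneg n ω j) (by positivity)) (sq_nonneg _))
    (hFi.add (integrable_const _)) ?_
  filter_upwards [hR.ae_sum_proportion hm n, hd] with ω h h'
  rw [sum_mul_norm_add_sq h]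
  have h5 : ∑ j, ((R n ω j / ((n : ℝ) + 1) : ℝ) : ℂ) * d j ω = 0 := by
    have : ∀ j, ((R n ω j / ((n : ℝ) + 1) : ℝ) : ℂ) * d j ω =
        w * (((R n ω j / ((n : ℝ) + 1) : ℝ) : ℂ) * cw m ^ (k * ((j : ℕ) + 1)) -
          ((R n ω j / ((n : ℝ) + 1) : ℝ) : ℂ) * (cw m ^ k / (n + 1) * ucoef m k (R n ω))) := by
      intro j; simp only [d]; ring
    simp_rw [this, ← Finset.mul_sum, Finset.sum_sub_distrib, ← Finset.sum_mul,
      sum_proportion_mul_cw, ← Complex.ofReal_sum, h]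
    simp
  rw [h5, mul_zero, Complex.zero_re, mul_zero, add_zero]
  refine add_le_add_right ?_ _
  calc _ ≤ ∑ j, R n ω j / ((n : ℝ) + 1) * (2 * ‖w‖) ^ 2 := by
        refine Finset.sum_le_sum fun j _ => mul_le_mul_of_nonneg_left ?_
          (div_nonneg (hR.nonneg n ω j) (by positivity))
        have := h' j
        gcongr
    _ = _ := by rw [← Finset.sum_mul, h]; ring

end IsCyclicUrn

lemma summable_norm_growth_inv_sq {z : ℂ} (hz : ‖z‖ = 1) (hre : 1 / 2 < z.re) :
    Summable fun i => ‖(growth z 0 (i + 1))⁻¹‖ ^ 2 := by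
  obtain ⟨n0, c, hn01, hc, h⟩ := coeff_properties hz hre.ne'
  obtain ⟨-, h2, h3⟩ := h n0 le_rfl
  have h4 : Summable fun i => ‖coeff z n0 i‖ ^ 2 := by
    refine Summable.of_nonneg_of_le (fun i => by positivity) (fun i => ?_)
      (h3.summable.mul_left c⁻¹)
    rw [← div_eq_inv_mul, le_div_iff₀ hc, mul_comm]
    exact h2 i
  rw [← summable_nat_add_iff n0]
  have h5 := ((summable_nat_add_iff n0).2 h4).mul_left (‖(growth z 0 n0)⁻¹‖ ^ 2)
  refine h5.congr fun i => ?_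
  rw [coeff_of_le hre (by omega), norm_neg, ← mul_pow, ← norm_mul, ← mul_inv,
    growth_mul z (Nat.zero_le _) (by omega)]

namespace IsCyclicUrn

lemma integral_norm_fluct_div_sub_sq_le (hm : 2 ≤ m) (hR : IsCyclicUrn μ m j0 R) {k : ℕ}
    (hre : 1 / 2 < (cw m ^ k).re) (n N : ℕ) (hN : n ≤ N) :
    ∫ ω, ‖fluct μ m k R N ω / growth (cw m ^ k) 0 N -
        fluct μ m k R n ω / growth (cw m ^ k) 0 n‖ ^ 2 ∂μ
      ≤ ∑ i ∈ Finset.Ico n N, 4 * ‖(growth (cw m ^ k) 0 (i + 1))⁻¹‖ ^ 2 := by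
  induction N, hN using Nat.le_induction with
  | base => simp
  | succ N hN ih =>
    rw [Finset.sum_Ico_succ_top hN]
    set g := growth (cw m ^ k) 0 with hg
    have hg0 : ∀ i, g i ≠ 0 := fun i => growth_ne_zero (by linarith) 0 i
    have h1 : ∀ ω, fluct μ m k R (N + 1) ω / g (N + 1) - fluct μ m k R n ω / g n =
        (fluct μ m k R N ω / g N - fluct μ m k R n ω / g n) +
          (g (N + 1))⁻¹ * urnInc m k R N ω := by
      intro ω
      have e : g (N + 1) = g N * (1 + cw m ^ k / (N + 1)) :=
        growth_succ_right _ (Nat.zero_le N)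
      have h2 := one_add_div_ne_zero (by linarith : 0 < (cw m ^ k).re) N
      have h3 := hg0 N
      rw [hR.fluct_succ hm, e, mul_inv, add_div, mul_comm (g N),
        mul_div_mul_left _ _ h2, div_eq_mul_inv (urnInc m k R N ω), mul_inv]
      ring
    simp_rw [h1]
    have hmeas : Measurable[urnFilt m R N]
        fun ω => fluct μ m k R N ω / g N - fluct μ m k R n ω / g n :=
      ((measurable_fluct k N).div_const _).sub
        (((measurable_fluct k n).mono (urnFilt_mono hN) le_rfl).div_const _)
    have hb : ∀ᵐ ω ∂μ, ‖fluct μ m k R N ω / g N - fluct μ m k R n ω / g n‖ ≤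
        2 * (N + 1) / ‖g N‖ + 2 * (n + 1) / ‖g n‖ := by
      filter_upwards [hR.ae_norm_fluct_le hm k N, hR.ae_norm_fluct_le hm k n] with ω h2 h3
      refine (norm_sub_le _ _).trans ?_
      rw [norm_div, norm_div]
      gcongr
    exact (hR.integral_norm_add_urnInc_sq_le hm k N _ hmeas hb).trans (by linarith)

/-- The normalised projections on the dominant eigendirections converge in mean. -/
lemma exists_fluct_limit (hm : 2 ≤ m) (hR : IsCyclicUrn μ m j0 R) {k : ℕ}
    (hre : 1 / 2 < (cw m ^ k).re) : ∃ Z : Ω → ℂ, Integrable Z μ ∧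
    Tendsto (fun n => ∫ ω, ‖fluct μ m k R n ω / growth (cw m ^ k) 0 n - Z ω‖ ∂μ)
      atTop (𝓝 0) := by
  have := hR.isProb
  have hs := (summable_norm_growth_inv_sq (norm_cw_pow m k) hre).mul_left 4
  have hinteg : ∀ n, Integrable (fun ω => fluct μ m k R n ω / growth (cw m ^ k) 0 n) μ :=
    fun n => (hR.integrable_fluct hm k n).div_const _
  refine exists_L1_limit hinteg
    (b := fun n => √(∑' i, 4 * ‖(growth (cw m ^ k) 0 (i + n + 1))⁻¹‖ ^ 2)) ?_ ?_
  · rw [← Real.sqrt_zero]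
    exact (tendsto_sum_nat_add fun i => 4 * ‖(growth (cw m ^ k) 0 (i + 1))⁻¹‖ ^ 2).sqrt
  · intro n N hN
    have hb : ∀ᵐ ω ∂μ, ‖fluct μ m k R N ω / growth (cw m ^ k) 0 N -
        fluct μ m k R n ω / growth (cw m ^ k) 0 n‖ ≤
        2 * (N + 1) / ‖growth (cw m ^ k) 0 N‖ + 2 * (n + 1) / ‖growth (cw m ^ k) 0 n‖ := by
      filter_upwards [hR.ae_norm_fluct_le hm k N, hR.ae_norm_fluct_le hm k n] with ω h2 h3
      refine (norm_sub_le _ _).trans ?_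
      rw [norm_div, norm_div]
      gcongr
    have hi := (hinteg N).sub (hinteg n)
    have hi2 : Integrable (fun ω => ‖fluct μ m k R N ω / growth (cw m ^ k) 0 N -
        fluct μ m k R n ω / growth (cw m ^ k) 0 n‖ ^ 2) μ := by
      refine Integrable.of_bound (C := (2 * (N + 1) / ‖growth (cw m ^ k) 0 N‖ +
        2 * (n + 1) / ‖growth (cw m ^ k) 0 n‖) ^ 2) (hi.aestronglyMeasurable.norm.pow 2) ?_
      filter_upwards [hb] with ω h
      rw [norm_pow, norm_norm]; gcongr
    refine (integral_le_sqrt_integral_sq hi.norm hi2).trans (Real.sqrt_le_sqrt ?_)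
    refine (hR.integral_norm_fluct_div_sub_sq_le hm hre n N hN).trans ?_
    rw [Finset.sum_Ico_eq_sum_range]
    have h5 := (summable_nat_add_iff n).2 hs
    refine le_trans (le_of_eq (Finset.sum_congr rfl fun i _ => ?_))
      (h5.sum_le_tsum (Finset.range (N - n)) (fun i _ => by positivity))
    rw [add_comm n i]

end IsCyclicUrn

end Fluctuations

section Reflection

lemma sum_Icc_reflect {M : Type*} [AddCommMonoid M] (m : ℕ) (f : ℕ → M) :
    ∑ k ∈ Finset.Icc 1 (m - 1), f (m - k) = ∑ k ∈ Finset.Icc 1 (m - 1), f k := by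
  refine Finset.sum_nbij' (fun k => m - k) (fun k => m - k) ?_ ?_ ?_ ?_ (fun _ _ => rfl)
  all_goals
    intro k hk
    simp only [Finset.mem_Icc] at hk ⊢
    omega

lemma sum_Icc_im_eq_zero {m : ℕ} {f : ℕ → ℂ}
    (hf : ∀ k ∈ Finset.Icc 1 (m - 1), (starRingEnd ℂ) (f k) = f (m - k)) :
    (∑ k ∈ Finset.Icc 1 (m - 1), f k).im = 0 := by
  rw [← Complex.conj_eq_iff_im, map_sum, Finset.sum_congr rfl hf, sum_Icc_reflect]

lemma sum_Icc_eq_ofReal_re {m : ℕ} {f : ℕ → ℂ}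
    (hf : ∀ k ∈ Finset.Icc 1 (m - 1), (starRingEnd ℂ) (f k) = f (m - k)) :
    (((∑ k ∈ Finset.Icc 1 (m - 1), f k).re : ℝ) : ℂ) = ∑ k ∈ Finset.Icc 1 (m - 1), f k :=
  Complex.ext rfl (by rw [sum_Icc_im_eq_zero hf, Complex.ofReal_im])

lemma lam_reflect {m k : ℕ} (hm : m ≠ 0) (hk : k ≤ m) : lam m (m - k) = lam m k := by
  rw [← cw_pow_re, ← cw_pow_re, cw_pow_sub hm hk, Complex.conj_re]

lemma half_lt_lam {m k : ℕ} (h : 6 * k < m) : 1 / 2 < lam m k := by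
  have hm : (0 : ℝ) < m := by exact_mod_cast (by omega : 0 < m)
  have h' : 6 * (k : ℝ) < m := by exact_mod_cast h
  have hpi := Real.pi_pos
  rw [lam, ← Real.cos_pi_div_three]
  refine Real.cos_lt_cos_of_nonneg_of_le_pi (by positivity) (by linarith) ?_
  rw [div_lt_div_iff₀ hm (by norm_num)]
  nlinarith

lemma lam_lt_half {m k : ℕ} (h : m < 6 * k) (h2 : 2 * k ≤ m) : lam m k < 1 / 2 := by
  have hm : (0 : ℝ) < m := by exact_mod_cast (by omega : 0 < m)
  have h' : (m : ℝ) < 6 * k := by exact_mod_cast h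
  have h2' : 2 * (k : ℝ) ≤ m := by exact_mod_cast h2
  have hpi := Real.pi_pos
  rw [lam, ← Real.cos_pi_div_three]
  refine Real.cos_lt_cos_of_nonneg_of_le_pi (by positivity) ?_ ?_
  · rw [div_le_iff₀ hm]; nlinarith
  · rw [div_lt_div_iff₀ (by norm_num) hm]; nlinarith

lemma lam_trichotomy {m k : ℕ} (h6 : ¬ 6 ∣ m) (hk : k ∈ Finset.Icc 1 (m - 1)) :
    (1 / 2 < lam m k ∧ (6 * k < m ∨ 6 * (m - k) < m)) ∨
      (lam m k < 1 / 2 ∧ ¬ (6 * k < m ∨ 6 * (m - k) < m)) := by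
  rw [Finset.mem_Icc] at hk
  rcases le_or_gt (2 * k) m with h2 | h2
  · rcases lt_or_ge (6 * k) m with h | h
    · exact Or.inl ⟨half_lt_lam h, Or.inl h⟩
    · exact Or.inr ⟨lam_lt_half (lt_of_le_of_ne h fun h' => h6 ⟨k, h'⟩) h2, by omega⟩
  · rw [← lam_reflect (by omega) (by omega : k ≤ m)]
    rcases lt_or_ge (6 * (m - k)) m with h | h
    · exact Or.inl ⟨half_lt_lam h, Or.inr h⟩
    · exact Or.inr ⟨lam_lt_half (lt_of_le_of_ne h fun h' => h6 ⟨m - k, h'⟩) (by omega), by omega⟩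

lemma lam_ne_half {m k : ℕ} (h6 : ¬ 6 ∣ m) (hk : k ∈ Finset.Icc 1 (m - 1)) :
    lam m k ≠ 1 / 2 := by
  rcases lam_trichotomy h6 hk with ⟨h1, -⟩ | ⟨h1, -⟩
  · exact h1.ne'
  · exact h1.ne

end Reflection

section Increments

/-- The coordinates of a linear functional in the eigenbasis. -/
def lcoef (m : ℕ) (l : Fin m → ℝ) (k : ℕ) : ℂ := ∑ t, (l t : ℂ) * vvec m k t

/-- The weight of the `i`-th draw along the `k`-th eigendirection. -/
def amp (m : ℕ) (l : Fin m → ℝ) (n i k : ℕ) : ℂ :=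
  lcoef m l k * coeff (cw m ^ k) n i / (√n : ℝ)

/-- The effect of drawing type `j` at step `i`, before centring. -/
def jump (m : ℕ) (l : Fin m → ℝ) (n i : ℕ) (j : Fin m) : ℝ :=
  (∑ k ∈ Finset.Icc 1 (m - 1), amp m l n i k * cw m ^ (k * ((j : ℕ) + 1))).re

/-- Total squared weight of the `i`-th draw. -/
def weight (m n i : ℕ) : ℝ := ∑ k ∈ Finset.Icc 1 (m - 1), ‖coeff (cw m ^ k) n i‖ ^ 2 / n

variable {m : ℕ} {l : Fin m → ℝ}

lemma conj_lcoef (l : Fin m → ℝ) {k : ℕ} (hk : k ≤ m) :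
    (starRingEnd ℂ) (lcoef m l k) = lcoef m l (m - k) := by
  simp only [lcoef, map_sum, map_mul, Complex.conj_ofReal]
  exact Finset.sum_congr rfl fun i _ => by rw [conj_vvec hk]

lemma conj_amp (hm : m ≠ 0) (l : Fin m → ℝ) (n i : ℕ) {k : ℕ} (hk : k ≤ m) :
    (starRingEnd ℂ) (amp m l n i k) = amp m l n i (m - k) := by
  simp only [amp, map_div₀, map_mul, Complex.conj_ofReal]
  rw [conj_lcoef l hk, cw_pow_sub hm hk, coeff_conj]

lemma ofReal_jump (hm : m ≠ 0) (l : Fin m → ℝ) (n i : ℕ) (j : Fin m) :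
    ((jump m l n i j : ℝ) : ℂ) =
      ∑ k ∈ Finset.Icc 1 (m - 1), amp m l n i k * cw m ^ (k * ((j : ℕ) + 1)) := by
  refine sum_Icc_eq_ofReal_re (f := fun k => amp m l n i k * cw m ^ (k * ((j : ℕ) + 1)))
    fun k hk => ?_
  rw [Finset.mem_Icc] at hk
  rw [map_mul, conj_amp hm l n i (by omega), pow_mul, map_pow, ← cw_pow_sub hm (by omega), pow_mul]

lemma sum_jump (hm : m ≠ 0) (l : Fin m → ℝ) (n i : ℕ) : ∑ j, jump m l n i j = 0 := by
  rw [← Complex.ofReal_inj, Complex.ofReal_sum]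
  simp_rw [ofReal_jump hm]
  rw [Finset.sum_comm, Complex.ofReal_zero]
  refine Finset.sum_eq_zero fun k hk => ?_
  rw [Finset.mem_Icc] at hk
  rw [← Finset.mul_sum, sum_cw_shift_eq_zero (by omega) (by omega), mul_zero]

lemma norm_amp_sq (l : Fin m → ℝ) (n i k : ℕ) :
    ‖amp m l n i k‖ ^ 2 = ‖lcoef m l k‖ ^ 2 * (‖coeff (cw m ^ k) n i‖ ^ 2 / n) := by
  rw [amp, norm_div, norm_mul, Complex.norm_real, Real.norm_eq_abs, abs_of_nonneg (by positivity),
    div_pow, mul_pow, Real.sq_sqrt (by positivity), mul_div_assoc]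

lemma sum_jump_sq (hm : m ≠ 0) (l : Fin m → ℝ) (n i : ℕ) :
    (∑ j, jump m l n i j ^ 2) / m = ∑ k ∈ Finset.Icc 1 (m - 1), ‖amp m l n i k‖ ^ 2 := by
  have hm' : (m : ℝ) ≠ 0 := by exact_mod_cast hm
  rw [div_eq_iff hm', ← Complex.ofReal_inj]
  push_cast
  have h1 : ∀ j, ((jump m l n i j : ℝ) : ℂ) ^ 2 = ∑ k ∈ Finset.Icc 1 (m - 1),
      ∑ k' ∈ Finset.Icc 1 (m - 1), (amp m l n i k * (starRingEnd ℂ) (amp m l n i k')) *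
        (cw m ^ (k * ((j : ℕ) + 1)) * (cw m ^ (k' * ((j : ℕ) + 1)))⁻¹) := by
    intro j
    rw [sq]
    nth_rw 2 [← Complex.conj_ofReal]
    rw [ofReal_jump hm, map_sum, Finset.sum_mul_sum]
    refine Finset.sum_congr rfl fun k _ => Finset.sum_congr rfl fun k' _ => ?_
    rw [map_mul, conj_cw_pow]; ring
  simp_rw [h1]
  rw [Finset.sum_comm, Finset.sum_mul]
  refine Finset.sum_congr rfl fun k hk => ?_
  rw [Finset.sum_comm]
  simp_rw [← Finset.mul_sum]
  rw [Finset.sum_eq_single k]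
  · rw [Finset.mem_Icc] at hk
    rw [sum_cw_shift (by omega) (by omega), if_pos rfl, Complex.mul_conj, Complex.normSq_eq_norm_sq]
    push_cast; rfl
  · intro k' hk' hne
    rw [Finset.mem_Icc] at hk hk'
    rw [sum_cw_shift (by omega) (by omega), if_neg (Ne.symm hne), mul_zero]
  · exact fun h => absurd hk h

lemma weight_nonneg (m n i : ℕ) : 0 ≤ weight m n i :=
  Finset.sum_nonneg fun _ _ => by positivity

lemma abs_jump_le (l : Fin m → ℝ) (n i : ℕ) (j : Fin m) :
    |jump m l n i j| ≤ √((∑ k ∈ Finset.Icc 1 (m - 1), ‖lcoef m l k‖ ^ 2) * weight m n i) := by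
  refine Real.le_sqrt_of_sq_le ?_
  have h1 : |jump m l n i j| ≤
      ∑ k ∈ Finset.Icc 1 (m - 1), ‖lcoef m l k‖ * (‖coeff (cw m ^ k) n i‖ / √n) := by
    refine (Complex.abs_re_le_norm _).trans ((norm_sum_le _ _).trans (le_of_eq ?_))
    refine Finset.sum_congr rfl fun k _ => ?_
    rw [norm_mul, norm_cw_pow, mul_one, amp, norm_div, norm_mul, Complex.norm_real,
      Real.norm_eq_abs, abs_of_nonneg (by positivity), mul_div_assoc]
  calc _ ≤ (∑ k ∈ Finset.Icc 1 (m - 1),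
        ‖lcoef m l k‖ * (‖coeff (cw m ^ k) n i‖ / √n)) ^ 2 := by gcongr
    _ ≤ _ := Finset.sum_mul_sq_le_sq_mul_sq _ _ _
    _ = _ := by
      congr 1
      refine Finset.sum_congr rfl fun k _ => ?_
      rw [div_pow, Real.sq_sqrt (by positivity)]

lemma re_cw_pow_ne_half (h6 : ¬ 6 ∣ m) {k : ℕ} (hk : k ∈ Finset.Icc 1 (m - 1)) :
    (cw m ^ k).re ≠ 1 / 2 := by
  rw [cw_pow_re]; exact lam_ne_half h6 hk

lemma eventually_weight_le (h6 : ¬ 6 ∣ m) :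
    ∀ᶠ n : ℕ in atTop, ∀ i, weight m n i ≤ m / (i + 1) := by
  have h : ∀ᶠ n : ℕ in atTop, ∀ k ∈ Finset.Icc 1 (m - 1), ∀ i : ℕ,
      ‖coeff (cw m ^ k) n i‖ ^ 2 / n ≤ 1 / (i + 1) := by
    rw [Filter.eventually_all_finset]
    intro k hk
    obtain ⟨n0, c, hn01, hc, h⟩ := coeff_properties (norm_cw_pow m k) (re_cw_pow_ne_half h6 hk)
    filter_upwards [eventually_ge_atTop n0] with n hn i
    have hn' : (0 : ℝ) < n := by exact_mod_cast (by omega : 0 < n)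
    have := (h n hn).1 i
    rw [div_le_iff₀ hn', one_div, inv_mul_eq_div]
    exact this
  filter_upwards [h] with n hn i
  refine (Finset.sum_le_sum fun k hk => hn k hk i).trans ?_
  rw [Finset.sum_const, Nat.card_Icc, nsmul_eq_mul, mul_one_div]
  gcongr
  omega

lemma weight_tendsto_zero (h6 : ¬ 6 ∣ m) (i : ℕ) :
    Tendsto (fun n => weight m n i) atTop (𝓝 0) := by
  rw [← Finset.sum_const_zero (s := Finset.Icc 1 (m - 1))]
  exact tendsto_finsetSum _ fun k hk =>
    coeff_tendsto_zero (norm_cw_pow m k) (re_cw_pow_ne_half h6 hk) i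

lemma eventually_weight_summable (h6 : ¬ 6 ∣ m) : ∃ C : ℝ, ∀ᶠ n : ℕ in atTop,
    (∀ k ∈ Finset.Icc 1 (m - 1), Summable fun i => ‖coeff (cw m ^ k) n i‖ ^ 2 / n) ∧
    Summable (weight m n) ∧ ∑' i, weight m n i ≤ C := by
  choose! C hC using fun k (hk : k ∈ Finset.Icc 1 (m - 1)) =>
    coeff_summable (norm_cw_pow m k) (re_cw_pow_ne_half h6 hk)
  refine ⟨∑ k ∈ Finset.Icc 1 (m - 1), C k, ?_⟩
  filter_upwards [(Filter.eventually_all_finset _).2 hC] with n hn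
  have hs : ∀ k ∈ Finset.Icc 1 (m - 1), Summable fun i => ‖coeff (cw m ^ k) n i‖ ^ 2 / n :=
    fun k hk => (hn k hk).1
  refine ⟨hs, summable_sum hs, ?_⟩
  unfold weight
  rw [Summable.tsum_finsetSum hs]
  exact Finset.sum_le_sum fun k hk => (hn k hk).2

/-- The limiting quadratic form. -/
def quadForm (m : ℕ) (l : Fin m → ℝ) : ℝ :=
  ∑ k ∈ Finset.Icc 1 (m - 1), |2 * lam m k - 1|⁻¹ * ‖lcoef m l k‖ ^ 2

lemma tendsto_quadForm (h6 : ¬ 6 ∣ m) (l : Fin m → ℝ) :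
    Tendsto (fun n : ℕ => ∑ k ∈ Finset.Icc 1 (m - 1),
      (∑' i, ‖coeff (cw m ^ k) n i‖ ^ 2 / n) * ‖lcoef m l k‖ ^ 2) atTop (𝓝 (quadForm m l)) := by
  refine tendsto_finsetSum _ fun k hk => ?_
  rw [← cw_pow_re]
  exact (coeff_tsum_tendsto (norm_cw_pow m k) (re_cw_pow_ne_half h6 hk)).mul_const _

end Increments

section CentralLimit

variable {Ω : Type*} [MeasurableSpace Ω] {μ : Measure Ω} {m : ℕ} {j0 : Fin m}
  {R : ℕ → Ω → Fin m → ℝ}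

lemma integrable_exp_ofReal_mul_I [IsProbabilityMeasure μ] {S : Ω → ℝ}
    (hS : AEStronglyMeasurable S μ) :
    Integrable (fun ω => Complex.exp ((S ω : ℂ) * Complex.I)) μ := by
  refine Integrable.of_bound (C := 1) ?_ (ae_of_all _ fun ω => ?_)
  · exact (by fun_prop : Continuous fun x : ℝ =>
      Complex.exp ((x : ℂ) * Complex.I)).comp_aestronglyMeasurable hS
  · rw [Complex.norm_exp_ofReal_mul_I]

lemma norm_integral_exp_sub_le [IsProbabilityMeasure μ] {S T : Ω → ℝ} (hS : Integrable S μ)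
    (hT : Integrable T μ) :
    ‖∫ ω, Complex.exp ((S ω : ℂ) * Complex.I) ∂μ - ∫ ω, Complex.exp ((T ω : ℂ) * Complex.I) ∂μ‖
      ≤ ∫ ω, |S ω - T ω| ∂μ := by
  rw [← integral_sub (integrable_exp_ofReal_mul_I hS.aestronglyMeasurable)
    (integrable_exp_ofReal_mul_I hT.aestronglyMeasurable)]
  refine norm_integral_le_of_norm_le (hS.sub hT).abs (ae_of_all _ fun ω => ?_)
  have h1 : Complex.exp ((S ω : ℂ) * Complex.I) - Complex.exp ((T ω : ℂ) * Complex.I) =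
      Complex.exp ((T ω : ℂ) * Complex.I) *
        (Complex.exp (Complex.I * ((S ω - T ω : ℝ) : ℂ)) - 1) := by
    rw [mul_sub, ← Complex.exp_add, mul_one]
    congr 2; push_cast; ring
  rw [h1, norm_mul, Complex.norm_exp_ofReal_mul_I, one_mul]
  exact Real.norm_exp_I_mul_ofReal_sub_one_le

/-- The fluctuations along the `k`-th eigendirection after removal of the dominant term. -/
def resid (μ : Measure Ω) (m : ℕ) (R : ℕ → Ω → Fin m → ℝ) (Z : ℕ → Ω → ℂ) (n k : ℕ) (ω : Ω) : ℂ :=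
  fluct μ m k R n ω -
    if 6 * k < m ∨ 6 * (m - k) < m then growth (cw m ^ k) 0 n * Z k ω else 0

namespace IsCyclicUrn

lemma exists_fluct_limits (hm : 2 ≤ m) (hR : IsCyclicUrn μ m j0 R) :
    ∃ Z : ℕ → Ω → ℂ, (∀ k, Integrable (Z k) μ) ∧
      (∀ k ∈ Finset.Icc 1 (m - 1), ∀ ω, (starRingEnd ℂ) (Z k ω) = Z (m - k) ω) ∧
      ∀ k ∈ Finset.Icc 1 (m - 1), (6 * k < m ∨ 6 * (m - k) < m) →
        Tendsto (fun n => ∫ ω, ‖fluct μ m k R n ω / growth (cw m ^ k) 0 n - Z k ω‖ ∂μ)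
          atTop (𝓝 0) := by
  have hex : ∀ k, 6 * k < m → ∃ Z : Ω → ℂ, Integrable Z μ ∧
      Tendsto (fun n => ∫ ω, ‖fluct μ m k R n ω / growth (cw m ^ k) 0 n - Z ω‖ ∂μ)
        atTop (𝓝 0) := fun k hk =>
    hR.exists_fluct_limit hm (by rw [cw_pow_re]; exact half_lt_lam hk)
  choose! Z hZi hZ using hex
  refine ⟨fun k ω => if 6 * k < m then Z k ω else
    if 6 * (m - k) < m then (starRingEnd ℂ) (Z (m - k) ω) else 0, ?_, ?_, ?_⟩
  · intro k
    simp only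
    split_ifs with h1 h2
    · exact hZi k h1
    · exact (Complex.conjLIE.toContinuousLinearEquiv.toContinuousLinearMap).integrable_comp
        (hZi _ h2)
    · exact integrable_zero _ _ _
  · intro k hk ω
    rw [Finset.mem_Icc] at hk
    have hkk : m - (m - k) = k := by omega
    simp only [hkk]
    by_cases h1 : 6 * k < m
    · rw [if_pos h1, if_neg (by omega), if_pos h1]
    · by_cases h2 : 6 * (m - k) < m
      · rw [if_neg h1, if_pos h2, if_pos h2, Complex.conj_conj]
      · rw [if_neg h1, if_neg h2, if_neg h2, map_zero]
        simp [h1]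
  · intro k hk h
    rw [Finset.mem_Icc] at hk
    by_cases h1 : 6 * k < m
    · simp only [if_pos h1]
      exact hZ k h1
    · have h2 : 6 * (m - k) < m := h.resolve_left h1
      simp only [if_neg h1, if_pos h2]
      refine (hZ (m - k) h2).congr fun n => integral_congr_ae (ae_of_all _ fun ω => ?_)
      simp only
      rw [← Complex.norm_conj, map_sub, map_div₀, ← growth_conj, cw_pow_sub (by omega) (by omega),
        Complex.conj_conj]
      simp only [fluct]
      rw [conj_ucoef (by omega), show m - (m - k) = k by omega]

lemma integrable_urnInc (hm : 2 ≤ m) (hR : IsCyclicUrn μ m j0 R) (k i : ℕ) :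
    Integrable (urnInc m k R i) μ :=
  (hR.integrable_ucoef hm (i + 1) k).sub ((hR.integrable_ucoef hm i k).const_mul _)

lemma integrable_resid (hm : 2 ≤ m) (hR : IsCyclicUrn μ m j0 R) {Z : ℕ → Ω → ℂ}
    (hZi : ∀ k, Integrable (Z k) μ) (n k : ℕ) : Integrable (resid μ m R Z n k) μ := by
  unfold resid
  refine (hR.integrable_fluct hm k n).sub ?_
  split_ifs
  · exact (hZi k).const_mul _
  · exact integrable_zero _ _ _

lemma fluct_div_growth (hm : 2 ≤ m) (hR : IsCyclicUrn μ m j0 R) {k : ℕ}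
    (hre : 0 < (cw m ^ k).re) (n : ℕ) (ω : Ω) :
    fluct μ m k R n ω / growth (cw m ^ k) 0 n =
      ∑ i ∈ Finset.range n, (growth (cw m ^ k) 0 (i + 1))⁻¹ * urnInc m k R i ω := by
  rw [hR.fluct_eq_sum hm, Finset.sum_div]
  refine Finset.sum_congr rfl fun i hi => ?_
  have h1 := growth_mul (cw m ^ k) (Nat.zero_le (i + 1)) (by simp at hi; omega : i + 1 ≤ n)
  have h2 := growth_ne_zero hre 0 (i + 1)
  have h3 := growth_ne_zero hre (i + 1) n
  rw [← h1]; field_simp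

/-- The residual is the limit of the weighted sums of martingale increments. -/
lemma tendsto_sum_coeff_urnInc (hm : 2 ≤ m) (h6 : ¬ 6 ∣ m) (hR : IsCyclicUrn μ m j0 R)
    {Z : ℕ → Ω → ℂ} {k : ℕ} (hk : k ∈ Finset.Icc 1 (m - 1))
    (hZ : (6 * k < m ∨ 6 * (m - k) < m) →
      Tendsto (fun n => ∫ ω, ‖fluct μ m k R n ω / growth (cw m ^ k) 0 n - Z k ω‖ ∂μ)
        atTop (𝓝 0)) (n : ℕ) :
    Tendsto (fun N => ∫ ω, ‖∑ i ∈ Finset.range N, coeff (cw m ^ k) n i * urnInc m k R i ω -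
      resid μ m R Z n k ω‖ ∂μ) atTop (𝓝 0) := by
  rcases lam_trichotomy h6 hk with ⟨h1, h2⟩ | ⟨h1, h2⟩
  · rw [← cw_pow_re] at h1
    have h3 := (hZ h2).const_mul ‖growth (cw m ^ k) 0 n‖
    rw [mul_zero] at h3
    refine h3.congr' ?_
    filter_upwards [eventually_ge_atTop n] with N hN
    rw [← integral_const_mul]
    refine integral_congr_ae (ae_of_all _ fun ω => ?_)
    simp only
    have h0 : ∀ i, growth (cw m ^ k) 0 i ≠ 0 := fun i => growth_ne_zero (by linarith) 0 i
    have h4 : ∑ i ∈ Finset.range N, coeff (cw m ^ k) n i * urnInc m k R i ω =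
        fluct μ m k R n ω - growth (cw m ^ k) 0 n *
          (fluct μ m k R N ω / growth (cw m ^ k) 0 N) := by
      rw [← Finset.sum_range_add_sum_Ico _ hN]
      rw [Finset.sum_eq_zero (s := Finset.range n) fun i hi => by
        rw [coeff_eq_zero h1 (by simpa using hi), zero_mul], zero_add]
      have h5 : fluct μ m k R n ω = growth (cw m ^ k) 0 n *
          (fluct μ m k R n ω / growth (cw m ^ k) 0 n) := by
        rw [mul_div_cancel₀ _ (h0 n)]
      rw [h5, ← mul_sub, hR.fluct_div_growth hm (by linarith), hR.fluct_div_growth hm (by linarith),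
        ← Finset.sum_range_add_sum_Ico (fun i => (growth (cw m ^ k) 0 (i + 1))⁻¹ *
          urnInc m k R i ω) hN, sub_add_cancel_left, mul_neg, Finset.mul_sum,
        ← Finset.sum_neg_distrib]
      refine Finset.sum_congr rfl fun i hi => ?_
      rw [Finset.mem_Ico] at hi
      have h6 := growth_mul (cw m ^ k) (Nat.zero_le n) (by omega : n ≤ i + 1)
      have h7 := h0 n
      have h8 := growth_ne_zero (by linarith : 0 < (cw m ^ k).re) n (i + 1)
      rw [coeff_of_le h1 (by omega), ← h6]; field_simp
    rw [h4, resid, if_pos h2, ← norm_mul, ← norm_neg]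
    congr 1; ring
  · rw [← cw_pow_re] at h1
    refine tendsto_const_nhds.congr' ?_
    filter_upwards [eventually_ge_atTop n] with N hN
    symm
    rw [integral_eq_zero_of_ae (ae_of_all _ fun ω => ?_)]
    simp only [Pi.zero_apply, norm_eq_zero, sub_eq_zero]
    rw [← Finset.sum_range_add_sum_Ico _ hN, resid, if_neg h2, sub_zero, hR.fluct_eq_sum hm,
      Finset.sum_eq_zero (s := Finset.Ico n N) fun i hi => by
        rw [coeff_of_not_lt h1 (by simp at hi; omega), zero_mul], add_zero]
    refine Finset.sum_congr rfl fun i hi => ?_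
    rw [coeff_of_lt h1 (by simpa using hi)]

/-- The rescaled linear functional of the residuals. -/
lemma norm_charFun_resid_sub_le (hm : 2 ≤ m) (h6 : ¬ 6 ∣ m) (hR : IsCyclicUrn μ m j0 R)
    {Z : ℕ → Ω → ℂ} (hZi : ∀ k, Integrable (Z k) μ)
    (hZ : ∀ k ∈ Finset.Icc 1 (m - 1), (6 * k < m ∨ 6 * (m - k) < m) →
      Tendsto (fun n => ∫ ω, ‖fluct μ m k R n ω / growth (cw m ^ k) 0 n - Z k ω‖ ∂μ)
        atTop (𝓝 0)) (l : Fin m → ℝ) {n : ℕ} (hw : ∀ i, weight m n i ≤ m / (i + 1))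
    (hs : ∀ k ∈ Finset.Icc 1 (m - 1), Summable fun i => ‖coeff (cw m ^ k) n i‖ ^ 2 / n)
    {δ : ℕ → ℝ} {B : ℝ} (hδB : ∀ i, δ i ≤ B)
    (hδ : ∀ i, δ i = 16 * √((∑ k ∈ Finset.Icc 1 (m - 1), ‖lcoef m l k‖ ^ 2) * (m / (i + 1))) +
      meanDev μ R i) :
    ‖∫ ω, Complex.exp ((((∑ k ∈ Finset.Icc 1 (m - 1), lcoef m l k / (√n : ℝ) *
        resid μ m R Z n k ω).re : ℝ) : ℂ) * Complex.I) ∂μ -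
      ((Real.exp (-(∑ k ∈ Finset.Icc 1 (m - 1),
        (∑' i, ‖coeff (cw m ^ k) n i‖ ^ 2 / n) * ‖lcoef m l k‖ ^ 2) / 2) : ℝ) : ℂ)‖ ≤
      (∑ k ∈ Finset.Icc 1 (m - 1), ‖lcoef m l k‖ ^ 2) * ∑' i, weight m n i * δ i := by
  have := hR.isProb
  set Λ := ∑ k ∈ Finset.Icc 1 (m - 1), ‖lcoef m l k‖ ^ 2 with hΛ
  have hΛ0 : 0 ≤ Λ := Finset.sum_nonneg fun _ _ => sq_nonneg _
  have hdev0 : ∀ i, 0 ≤ meanDev μ R i := fun i =>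
    integral_nonneg fun ω => Finset.sum_nonneg fun _ _ => abs_nonneg _
  have hδ0 : ∀ i, 0 ≤ δ i := fun i => by
    rw [hδ]; have := hdev0 i; positivity
  have hws : Summable (weight m n) := summable_sum hs
  have hwδ : Summable fun i => weight m n i * δ i :=
    Summable.of_nonneg_of_le (fun i => mul_nonneg (weight_nonneg m n i) (hδ0 i))
      (fun i => mul_le_mul_of_nonneg_left (hδB i) (weight_nonneg m n i)) (hws.mul_right B)
  let ξ : ℕ → Ω → ℝ := fun i ω =>
    (∑ k ∈ Finset.Icc 1 (m - 1), amp m l n i k * urnInc m k R i ω).re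
  have hξm : ∀ i, Measurable[urnFilt m R (i + 1)] (ξ i) := fun i =>
    Complex.measurable_re.comp (Finset.measurable_sum _ fun k _ =>
      (measurable_urnInc k i).const_mul _)
  have hξ : ∀ i j, ∀ ω ∈ drawSet m R i j, ξ i ω =
      jump m l n i j - ∑ t, R i ω t / (i + 1) * jump m l n i t := by
    intro i j ω hω
    have h1 : ∀ k, amp m l n i k * urnInc m k R i ω = amp m l n i k * cw m ^ (k * ((j : ℕ) + 1)) -
        ∑ t : Fin m, ((R i ω t / (i + 1) : ℝ) : ℂ) *
          (amp m l n i k * cw m ^ (k * ((t : ℕ) + 1))) := by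
      intro k
      rw [urnInc_drawSet hm hω, ← sum_proportion_mul_cw, mul_sub, Finset.mul_sum]
      congr 1
      exact Finset.sum_congr rfl fun t _ => by ring
    simp only [ξ]
    simp_rw [h1]
    rw [Finset.sum_sub_distrib, Complex.sub_re, Finset.sum_comm, Complex.re_sum (s := Finset.univ)]
    congr 1
    refine Finset.sum_congr rfl fun t _ => ?_
    rw [← Finset.mul_sum, Complex.re_ofReal_mul]; rfl
  have hbound := hR.norm_charFun_sub_le hm (fun i j => abs_jump_le l n i j)
    (fun i => sum_jump (by omega) l n i) hξm hξ
  have hle : ∀ N, ∑ i ∈ Finset.range N, (16 * √(Λ * weight m n i) ^ 3 +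
      √(Λ * weight m n i) ^ 2 * meanDev μ R i) ≤ Λ * ∑' i, weight m n i * δ i := by
    intro N
    refine le_trans ?_ (mul_le_mul_of_nonneg_left (hwδ.sum_le_tsum (Finset.range N)
      (fun i _ => mul_nonneg (weight_nonneg m n i) (hδ0 i))) hΛ0)
    rw [Finset.mul_sum]
    refine Finset.sum_le_sum fun i _ => ?_
    have hw0 := weight_nonneg m n i
    have h1 : √(Λ * weight m n i) ^ 2 = Λ * weight m n i := Real.sq_sqrt (mul_nonneg hΛ0 hw0)
    have h2 : √(Λ * weight m n i) ≤ √(Λ * (m / (i + 1))) :=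
      Real.sqrt_le_sqrt (mul_le_mul_of_nonneg_left (hw i) hΛ0)
    have h3 : √(Λ * weight m n i) ^ 3 = Λ * weight m n i * √(Λ * weight m n i) := by
      rw [← h1]; simp only [Real.sqrt_sq (Real.sqrt_nonneg _)]; ring
    rw [h3, h1, hδ]
    have h4 := mul_le_mul_of_nonneg_left h2 (mul_nonneg hΛ0 hw0)
    nlinarith
  have hsum : ∀ N ω, ∑ i ∈ Finset.range N, ξ i ω =
      (∑ k ∈ Finset.Icc 1 (m - 1), lcoef m l k / (√n : ℝ) *
        ∑ i ∈ Finset.range N, coeff (cw m ^ k) n i * urnInc m k R i ω).re := by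
    intro N ω
    simp only [ξ]
    rw [← Complex.re_sum, Finset.sum_comm]
    congr 1
    refine Finset.sum_congr rfl fun k _ => ?_
    rw [Finset.mul_sum]
    exact Finset.sum_congr rfl fun i _ => by rw [amp]; ring
  have hUi : ∀ N k, Integrable (fun ω =>
      ∑ i ∈ Finset.range N, coeff (cw m ^ k) n i * urnInc m k R i ω) μ := fun N k =>
    integrable_finsetSum _ fun i _ => (hR.integrable_urnInc hm k i).const_mul _
  have hSi : Integrable (fun ω => (∑ k ∈ Finset.Icc 1 (m - 1), lcoef m l k / (√n : ℝ) *
      resid μ m R Z n k ω).re) μ :=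
    (integrable_finsetSum _ fun k _ => (hR.integrable_resid hm hZi n k).const_mul _).re
  have hTi : ∀ N, Integrable (fun ω => ∑ i ∈ Finset.range N, ξ i ω) μ := by
    intro N
    simp_rw [hsum]
    exact (integrable_finsetSum _ fun k _ => (hUi N k).const_mul _).re
  have hlim1 : Tendsto (fun N => ∫ ω, Complex.exp (((∑ i ∈ Finset.range N, ξ i ω : ℝ) : ℂ) *
      Complex.I) ∂μ) atTop (𝓝 (∫ ω, Complex.exp ((((∑ k ∈ Finset.Icc 1 (m - 1),
        lcoef m l k / (√n : ℝ) * resid μ m R Z n k ω).re : ℝ) : ℂ) * Complex.I) ∂μ)) := by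
    rw [tendsto_iff_norm_sub_tendsto_zero]
    have h0 : Tendsto (fun N => ∑ k ∈ Finset.Icc 1 (m - 1), ‖lcoef m l k / (√n : ℝ)‖ *
        ∫ ω, ‖∑ i ∈ Finset.range N, coeff (cw m ^ k) n i * urnInc m k R i ω -
          resid μ m R Z n k ω‖ ∂μ) atTop (𝓝 0) := by
      rw [← Finset.sum_const_zero (s := Finset.Icc 1 (m - 1))]
      refine tendsto_finsetSum _ fun k hk => ?_
      rw [← mul_zero ‖lcoef m l k / (√n : ℝ)‖]
      exact (hR.tendsto_sum_coeff_urnInc hm h6 hk (hZ k hk) n).const_mul _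
    refine squeeze_zero (fun N => norm_nonneg _) (fun N => ?_) h0
    refine (norm_integral_exp_sub_le (hTi N) hSi).trans ?_
    simp_rw [← integral_const_mul]
    have hi : ∀ k ∈ Finset.Icc 1 (m - 1), Integrable (fun ω => ‖lcoef m l k / (√n : ℝ)‖ *
        ‖∑ i ∈ Finset.range N, coeff (cw m ^ k) n i * urnInc m k R i ω -
          resid μ m R Z n k ω‖) μ := fun k _ =>
      ((hUi N k).sub (hR.integrable_resid hm hZi n k)).norm.const_mul _
    rw [← integral_finsetSum _ hi]
    refine integral_mono ((hTi N).sub hSi).abs (integrable_finsetSum _ hi) fun ω => ?_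
    simp only
    rw [hsum, ← Complex.sub_re, ← Finset.sum_sub_distrib]
    refine (Complex.abs_re_le_norm _).trans ((norm_sum_le _ _).trans (le_of_eq ?_))
    exact Finset.sum_congr rfl fun k _ => by rw [← mul_sub, norm_mul]
  have hlim2 : Tendsto (fun N => ((Real.exp (-(∑ i ∈ Finset.range N,
      (∑ j, jump m l n i j ^ 2) / m) / 2) : ℝ) : ℂ)) atTop
      (𝓝 ((Real.exp (-(∑ k ∈ Finset.Icc 1 (m - 1),
        (∑' i, ‖coeff (cw m ^ k) n i‖ ^ 2 / n) * ‖lcoef m l k‖ ^ 2) / 2) : ℝ) : ℂ)) := by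
    have h1 : HasSum (fun i => (∑ j, jump m l n i j ^ 2) / m) (∑ k ∈ Finset.Icc 1 (m - 1),
        (∑' i, ‖coeff (cw m ^ k) n i‖ ^ 2 / n) * ‖lcoef m l k‖ ^ 2) := by
      have h2 : ∀ i, (∑ j, jump m l n i j ^ 2) / m = ∑ k ∈ Finset.Icc 1 (m - 1),
          (‖coeff (cw m ^ k) n i‖ ^ 2 / n) * ‖lcoef m l k‖ ^ 2 := fun i => by
        rw [sum_jump_sq (by omega)]
        exact Finset.sum_congr rfl fun k _ => by rw [norm_amp_sq, mul_comm]
      simp_rw [h2]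
      exact hasSum_sum fun k hk => (hs k hk).hasSum.mul_right _
    have h3 := ((h1.tendsto_sum_nat.neg.div_const 2).rexp).ofReal
    exact h3
  exact le_of_tendsto (hlim1.sub hlim2).norm
    (Eventually.of_forall fun N => (hbound N).trans (hle N))

/-- Characteristic functions of the rescaled residuals. -/
lemma tendsto_charFun_resid (hm : 2 ≤ m) (h6 : ¬ 6 ∣ m) (hR : IsCyclicUrn μ m j0 R)
    {Z : ℕ → Ω → ℂ} (hZi : ∀ k, Integrable (Z k) μ)
    (hZ : ∀ k ∈ Finset.Icc 1 (m - 1), (6 * k < m ∨ 6 * (m - k) < m) →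
      Tendsto (fun n => ∫ ω, ‖fluct μ m k R n ω / growth (cw m ^ k) 0 n - Z k ω‖ ∂μ)
        atTop (𝓝 0)) (l : Fin m → ℝ) :
    Tendsto (fun n : ℕ => ∫ ω, Complex.exp ((((∑ k ∈ Finset.Icc 1 (m - 1),
      lcoef m l k / (√n : ℝ) * resid μ m R Z n k ω).re : ℝ) : ℂ) * Complex.I) ∂μ) atTop
      (𝓝 ((Real.exp (-quadForm m l / 2) : ℝ) : ℂ)) := by
  set Λ := ∑ k ∈ Finset.Icc 1 (m - 1), ‖lcoef m l k‖ ^ 2 with hΛ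
  let δ : ℕ → ℝ := fun i => 16 * √(Λ * (m / (i + 1))) + meanDev μ R i
  have hδ : Tendsto δ atTop (𝓝 0) := by
    have h1 : Tendsto (fun i : ℕ => (m : ℝ) / (i + 1)) atTop (𝓝 0) := by
      have := (tendsto_one_div_add_atTop_nhds_zero_nat (𝕜 := ℝ)).const_mul (m : ℝ)
      simpa [div_eq_mul_inv] using this
    have h2 := ((h1.const_mul Λ).sqrt.const_mul 16).add (hR.tendsto_meanDev hm)
    simpa using h2
  obtain ⟨B, hB⟩ : ∃ B, ∀ i, δ i ≤ B := by
    obtain ⟨B, hB⟩ := (Metric.isBounded_range_of_tendsto δ hδ).exists_norm_le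
    exact ⟨B, fun i => (le_abs_self _).trans (hB _ ⟨i, rfl⟩)⟩
  obtain ⟨C, hC⟩ := eventually_weight_summable h6
  have h1 := (tendsto_tsum_mul_zero (weight_nonneg m) (hC.mono fun n hn => hn.2)
    (weight_tendsto_zero h6) hδ).const_mul Λ
  rw [mul_zero] at h1
  have h2 : Tendsto (fun n : ℕ => ((Real.exp (-(∑ k ∈ Finset.Icc 1 (m - 1),
      (∑' i, ‖coeff (cw m ^ k) n i‖ ^ 2 / n) * ‖lcoef m l k‖ ^ 2) / 2) : ℝ) : ℂ)) atTop
      (𝓝 ((Real.exp (-quadForm m l / 2) : ℝ) : ℂ)) :=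
    (((tendsto_quadForm h6 l).neg.div_const 2).rexp).ofReal
  have h3 := squeeze_zero_norm' (a := fun n => Λ * ∑' i, weight m n i * δ i) (by
    filter_upwards [hC, eventually_weight_le h6] with n hn hw
    exact hR.norm_charFun_resid_sub_le hm h6 hZi hZ l hw hn.1 hB (fun i => rfl)) h1
  simpa using h3.add h2

end IsCyclicUrn

end CentralLimit

section Recentring

variable {Ω : Type*} [MeasurableSpace Ω] {μ : Measure Ω} {m : ℕ} {j0 : Fin m}
  {R : ℕ → Ω → Fin m → ℝ}

lemma re_sum_Icc_dominant {f : ℕ → ℂ}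
    (hf : ∀ k ∈ Finset.Icc 1 (m - 1), (starRingEnd ℂ) (f k) = f (m - k)) :
    (∑ k ∈ Finset.Icc 1 (m - 1), if 6 * k < m ∨ 6 * (m - k) < m then f k else 0).re =
      ∑ k ∈ Finset.Icc 1 ((m - 1) / 6), 2 * (f k).re := by
  have h1 : ∀ k ∈ Finset.Icc 1 (m - 1),
      (if 6 * k < m ∨ 6 * (m - k) < m then f k else 0).re =
        (if 6 * k < m then (f k).re else 0) +
          (if 6 * (m - k) < m then (f (m - k)).re else 0) := by
    intro k hk
    rw [← hf k hk, Complex.conj_re]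
    rw [Finset.mem_Icc] at hk
    by_cases ha : 6 * k < m
    · rw [if_pos (Or.inl ha), if_pos ha, if_neg (by omega), add_zero]
    · by_cases hb : 6 * (m - k) < m
      · rw [if_pos (Or.inr hb), if_neg ha, if_pos hb, zero_add]
      · rw [if_neg (by tauto), if_neg ha, if_neg hb, add_zero, Complex.zero_re]
  rw [Complex.re_sum, Finset.sum_congr rfl h1, Finset.sum_add_distrib,
    sum_Icc_reflect m (fun k => if 6 * k < m then (f k).re else 0), ← two_mul,
    ← Finset.sum_filter, ← Finset.mul_sum]
  congr 2
  ext k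
  simp only [Finset.mem_filter, Finset.mem_Icc]
  omega

namespace IsCyclicUrn

lemma ae_fluct_zero_dir (hm : 2 ≤ m) (hR : IsCyclicUrn μ m j0 R) (n : ℕ) :
    ∀ᵐ ω ∂μ, fluct μ m 0 R n ω = 0 := by
  have := hR.isProb
  have h : ∀ᵐ ω ∂μ, ucoef m 0 (R n ω) = (n : ℂ) + 1 := by
    filter_upwards [hR.ae_sum hm n] with ω h
    rw [ucoef_zero, ← Complex.ofReal_sum, h]
    push_cast; rfl
  filter_upwards [h] with ω hω
  rw [hR.fluct_eq, integral_congr_ae h, hω]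
  simp

lemma ae_sum_mul_eq (hm : 2 ≤ m) (hR : IsCyclicUrn μ m j0 R) (l : Fin m → ℝ) (n : ℕ) :
    ∀ᵐ ω ∂μ, ∑ i, l i * (R n ω i - expVec μ (R n) i) =
      (∑ k ∈ Finset.Icc 1 (m - 1), lcoef m l k * fluct μ m k R n ω).re := by
  filter_upwards [hR.ae_fluct_zero_dir hm n] with ω h
  rw [← Complex.ofReal_re (∑ i, l i * (R n ω i - expVec μ (R n) i))]
  congr 1
  have h1 : ∀ i, ((R n ω i - expVec μ (R n) i : ℝ) : ℂ) =
      ∑ k ∈ Finset.Icc 1 (m - 1), fluct μ m k R n ω * vvec m k i := fun i => by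
    rw [← sum_ucoef_mul_vvec (fun t => R n ω t - expVec μ (R n) t) i,
      sum_range_eq_add_Icc (by omega)]
    change fluct μ m 0 R n ω * _ + _ = _
    rw [h, zero_mul, zero_add]
    rfl
  rw [Complex.ofReal_sum]
  simp_rw [Complex.ofReal_mul, h1, Finset.mul_sum]
  rw [Finset.sum_comm]
  refine Finset.sum_congr rfl fun k _ => ?_
  rw [lcoef, Finset.sum_mul]
  exact Finset.sum_congr rfl fun i _ => by ring

/-- Convergence of the characteristic functions of the recentred and rescaled compositions. -/
lemma exists_tendsto_charFun (hm : 2 ≤ m) (h6 : ¬ 6 ∣ m) (hR : IsCyclicUrn μ m j0 R) :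
    ∃ Ξ : ℕ → Ω → ℂ, (∀ k, Integrable (Ξ k) μ) ∧ ∀ l : Fin m → ℝ,
      Tendsto (fun n : ℕ => ∫ ω, Complex.exp (((∑ i, l i * ((√n)⁻¹ *
          (R n ω i - expVec μ (R n) i - ∑ k ∈ Finset.Icc 1 ((m - 1) / 6),
            2 * ((n : ℂ) ^ (cw m ^ k) * Ξ k ω * vvec m k i).re)) : ℝ) : ℂ) * Complex.I) ∂μ) atTop
        (𝓝 ((Real.exp (-quadForm m l / 2) : ℝ) : ℂ)) := by
  have := hR.isProb
  obtain ⟨Z, hZi, hZc, hZ⟩ := hR.exists_fluct_limits hm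
  have hg : ∀ k, 6 * k < m → ∃ c : ℂ, ∃ C : ℝ, ∀ n : ℕ, n ≥ 1 →
      ‖growth (cw m ^ k) 0 n - (n : ℂ) ^ (cw m ^ k) * c‖ ≤ C := fun k hk =>
    growth_asymptotic (norm_cw_pow m k)
      (by rw [cw_pow_re]; linarith [half_lt_lam hk])
  choose! c C hcC using hg
  refine ⟨fun k ω => c k * Z k ω, fun k => (hZi k).const_mul _, fun l => ?_⟩
  have hsmall : ∀ k ∈ Finset.Icc 1 ((m - 1) / 6), 6 * k < m := fun k hk => by
    rw [Finset.mem_Icc] at hk; omega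
  let X : ℕ → Ω → ℝ := fun n ω => ∑ i, l i * ((√n)⁻¹ *
    (R n ω i - expVec μ (R n) i - ∑ k ∈ Finset.Icc 1 ((m - 1) / 6),
      2 * ((n : ℂ) ^ (cw m ^ k) * (c k * Z k ω) * vvec m k i).re))
  let S : ℕ → Ω → ℝ := fun n ω => (∑ k ∈ Finset.Icc 1 (m - 1),
    lcoef m l k / (√n : ℝ) * resid μ m R Z n k ω).re
  have hXi : ∀ n, Integrable (X n) μ := fun n => by
    refine integrable_finsetSum _ fun i _ => Integrable.const_mul (Integrable.const_mul ?_ _) _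
    refine ((hR.integrable_coord n i).sub (integrable_const _)).sub ?_
    refine integrable_finsetSum _ fun k _ => ?_
    have h := (((hZi k).const_mul (c k)).const_mul ((n : ℂ) ^ (cw m ^ k))).mul_const (vvec m k i)
    exact h.re.const_mul 2
  have hSi : ∀ n, Integrable (S n) μ := fun n =>
    Integrable.re (integrable_finsetSum _ fun k _ =>
      (hR.integrable_resid hm hZi n k).const_mul _)
  have hdiff : ∀ n, ∀ᵐ ω ∂μ, X n ω - S n ω = (√n)⁻¹ * ∑ k ∈ Finset.Icc 1 ((m - 1) / 6),
      2 * (lcoef m l k * ((growth (cw m ^ k) 0 n - (n : ℂ) ^ (cw m ^ k) * c k) * Z k ω)).re := by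
    intro n
    filter_upwards [hR.ae_sum_mul_eq hm l n] with ω hω
    have hX : X n ω = (√n)⁻¹ * ((∑ k ∈ Finset.Icc 1 (m - 1), lcoef m l k * fluct μ m k R n ω).re -
        ∑ k ∈ Finset.Icc 1 ((m - 1) / 6),
          2 * (lcoef m l k * ((n : ℂ) ^ (cw m ^ k) * c k * Z k ω)).re) := by
      have h1 : ∑ k ∈ Finset.Icc 1 ((m - 1) / 6),
          2 * (lcoef m l k * ((n : ℂ) ^ (cw m ^ k) * c k * Z k ω)).re =
          ∑ i, l i * ∑ k ∈ Finset.Icc 1 ((m - 1) / 6),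
            2 * ((n : ℂ) ^ (cw m ^ k) * (c k * Z k ω) * vvec m k i).re := by
        simp_rw [Finset.mul_sum]
        rw [Finset.sum_comm]
        refine Finset.sum_congr rfl fun k _ => ?_
        rw [lcoef, Finset.sum_mul, Complex.re_sum, Finset.mul_sum]
        refine Finset.sum_congr rfl fun i _ => ?_
        rw [show (l i : ℂ) * vvec m k i * ((n : ℂ) ^ (cw m ^ k) * c k * Z k ω) =
          (l i : ℂ) * ((n : ℂ) ^ (cw m ^ k) * (c k * Z k ω) * vvec m k i) by ring,
          Complex.re_ofReal_mul]
        ring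
      rw [h1, ← hω, ← Finset.sum_sub_distrib, Finset.mul_sum]
      exact Finset.sum_congr rfl fun i _ => by ring
    have hS : S n ω = (√n)⁻¹ * ((∑ k ∈ Finset.Icc 1 (m - 1), lcoef m l k * fluct μ m k R n ω).re -
        ∑ k ∈ Finset.Icc 1 ((m - 1) / 6),
          2 * (lcoef m l k * (growth (cw m ^ k) 0 n * Z k ω)).re) := by
      rw [← re_sum_Icc_dominant (f := fun k => lcoef m l k * (growth (cw m ^ k) 0 n * Z k ω)),
        ← Complex.sub_re, ← Complex.re_ofReal_mul, ← Finset.sum_sub_distrib, Finset.mul_sum]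
      · refine congrArg Complex.re (Finset.sum_congr rfl fun k _ => ?_)
        rw [resid]
        push_cast
        split_ifs <;> ring
      · intro k hk
        have hk' := Finset.mem_Icc.1 hk
        rw [map_mul, map_mul, conj_lcoef l (by omega), hZc k hk ω, ← growth_conj,
          cw_pow_sub (by omega) (by omega)]
    rw [hX, hS, ← mul_sub, sub_sub_sub_cancel_left, ← Finset.sum_sub_distrib]
    congr 1
    refine Finset.sum_congr rfl fun k _ => ?_
    rw [← mul_sub, ← Complex.sub_re]
    congr 2; ring
  set K := ∑ k ∈ Finset.Icc 1 ((m - 1) / 6), 2 * (‖lcoef m l k‖ * (C k * ∫ ω, ‖Z k ω‖ ∂μ)) with hK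
  have hbound : ∀ n : ℕ, n ≥ 1 → ∫ ω, |X n ω - S n ω| ∂μ ≤ (√n)⁻¹ * K := by
    intro n hn
    have h1 : Integrable (fun ω => (√n)⁻¹ * ∑ k ∈ Finset.Icc 1 ((m - 1) / 6),
        2 * (‖lcoef m l k‖ * (C k * ‖Z k ω‖))) μ :=
      Integrable.const_mul (integrable_finsetSum _ fun k _ =>
        (((hZi k).norm.const_mul _).const_mul _).const_mul _) _
    calc ∫ ω, |X n ω - S n ω| ∂μ
        ≤ ∫ ω, (√n)⁻¹ * ∑ k ∈ Finset.Icc 1 ((m - 1) / 6),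
            2 * (‖lcoef m l k‖ * (C k * ‖Z k ω‖)) ∂μ := by
          refine integral_mono_ae ((hXi n).sub (hSi n)).abs h1 ?_
          filter_upwards [hdiff n] with ω hω
          rw [hω, abs_mul, abs_of_nonneg (by positivity)]
          refine mul_le_mul_of_nonneg_left ((Finset.abs_sum_le_sum_abs _ _).trans
            (Finset.sum_le_sum fun k hk => ?_)) (by positivity)
          rw [abs_mul, abs_two]
          refine mul_le_mul_of_nonneg_left ((Complex.abs_re_le_norm _).trans ?_) zero_le_two
          rw [norm_mul, norm_mul]
          gcongr
          exact hcC k (hsmall k hk) n hn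
      _ = (√n)⁻¹ * K := by
          rw [integral_const_mul, integral_finsetSum _ fun k _ =>
            (((hZi k).norm.const_mul _).const_mul _).const_mul _]
          simp_rw [integral_const_mul]
          rfl
  have hK0 : Tendsto (fun n : ℕ => (√n)⁻¹ * K) atTop (𝓝 0) := by
    have h1 : Tendsto (fun n : ℕ => (√(n : ℝ))⁻¹) atTop (𝓝 0) :=
      tendsto_inv_atTop_zero.comp (Real.tendsto_sqrt_atTop.comp tendsto_natCast_atTop_atTop)
    simpa using h1.mul_const K
  have h3 : Tendsto (fun n => (∫ ω, Complex.exp ((X n ω : ℂ) * Complex.I) ∂μ) -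
      ∫ ω, Complex.exp ((S n ω : ℂ) * Complex.I) ∂μ) atTop (𝓝 0) :=
    squeeze_zero_norm' (eventually_atTop.2 ⟨1, fun n hn =>
      (norm_integral_exp_sub_le (hXi n) (hSi n)).trans (hbound n hn)⟩) hK0
  have h4 := h3.add (hR.tendsto_charFun_resid hm h6 hZi hZ l)
  rw [zero_add] at h4
  exact h4.congr fun n => sub_add_cancel _ _

end IsCyclicUrn

end Recentring

section Covariance

variable {m : ℕ}

lemma conj_cSigmaA_summand (i j : Fin m) {k : ℕ} (hk : k ∈ Finset.Icc 1 (m - 1)) :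
    (starRingEnd ℂ) (((|2 * lam m k - 1|⁻¹ : ℝ) : ℂ) * (vvec m k i * star (vvec m k j))) =
      ((|2 * lam m (m - k) - 1|⁻¹ : ℝ) : ℂ) * (vvec m (m - k) i * star (vvec m (m - k) j)) := by
  rw [Finset.mem_Icc] at hk
  simp only [map_mul, Complex.conj_ofReal, Complex.star_def]
  rw [lam_reflect (by omega) (by omega), conj_vvec (by omega), conj_vvec (by omega)]

lemma cSigmaA_im (i j : Fin m) : (cSigmaA m i j).im = 0 :=
  sum_Icc_im_eq_zero fun _ hk => conj_cSigmaA_summand i j hk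

lemma ofReal_rSigmaA (i j : Fin m) : ((rSigmaA m i j : ℝ) : ℂ) = cSigmaA m i j :=
  sum_Icc_eq_ofReal_re fun _ hk => conj_cSigmaA_summand i j hk

lemma rSigmaA_isSymm (m : ℕ) : (rSigmaA m).IsSymm := by
  refine Matrix.IsSymm.ext fun i j => ?_
  rw [← Complex.ofReal_inj, ← Complex.conj_ofReal, ofReal_rSigmaA, ofReal_rSigmaA]
  simp only [cSigmaA, Matrix.of_apply, map_sum, map_mul, Complex.conj_ofReal, Complex.star_def,
    Complex.conj_conj]
  exact Finset.sum_congr rfl fun k _ => by ring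

lemma sum_mul_rSigmaA_mul (l : Fin m → ℝ) : ∑ i, ∑ j, l i * rSigmaA m i j * l j = quadForm m l := by
  rw [← Complex.ofReal_inj, quadForm]
  push_cast
  simp_rw [ofReal_rSigmaA, ← Complex.conj_mul', cSigmaA, Matrix.of_apply, Finset.mul_sum,
    Finset.sum_mul]
  simp_rw [Finset.sum_comm (s := (Finset.univ : Finset (Fin m))) (t := Finset.Icc 1 (m - 1))]
  refine Finset.sum_congr rfl fun k _ => ?_
  simp only [lcoef, map_sum, map_mul, Complex.conj_ofReal]
  rw [Finset.sum_mul_sum, Finset.mul_sum, Finset.sum_comm]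
  simp_rw [Finset.mul_sum]
  refine Finset.sum_congr rfl fun i _ => Finset.sum_congr rfl fun j _ => ?_
  rw [Complex.star_def]
  push_cast
  ring

lemma dotProduct_rSigmaA_mulVec (l : Fin m → ℝ) : l ⬝ᵥ (rSigmaA m).mulVec l = quadForm m l := by
  rw [← sum_mul_rSigmaA_mul]
  simp only [dotProduct, Matrix.mulVec, Finset.mul_sum, mul_assoc]

lemma quadForm_nonneg (l : Fin m → ℝ) : 0 ≤ quadForm m l :=
  Finset.sum_nonneg fun _ _ => by positivity

lemma rSigmaA_posSemidef (m : ℕ) : (rSigmaA m).PosSemidef := by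
  refine Matrix.PosSemidef.of_dotProduct_mulVec_nonneg ?_ fun x => ?_
  · rw [Matrix.IsHermitian, Matrix.conjTranspose_eq_transpose_of_trivial]
    exact rSigmaA_isSymm m
  · rw [star_trivial, dotProduct_rSigmaA_mulVec]
    exact quadForm_nonneg x

lemma conj_lcoef_eq_ucoef (l : Fin m → ℝ) (k : ℕ) :
    (starRingEnd ℂ) (lcoef m l k) = (m : ℂ)⁻¹ * ucoef m k l := by
  simp only [lcoef, ucoef, vvec, map_sum, map_mul, Complex.conj_ofReal, zpow_neg, zpow_natCast,
    ← conj_cw_pow, Complex.conj_conj, map_inv₀, Complex.conj_natCast, Finset.mul_sum]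
  exact Finset.sum_congr rfl fun t _ => by ring

lemma lcoef_eq_zero_iff (hm : m ≠ 0) (l : Fin m → ℝ) (k : ℕ) :
    lcoef m l k = 0 ↔ ucoef m k l = 0 := by
  rw [← map_eq_zero (starRingEnd ℂ), conj_lcoef_eq_ucoef]
  simp [hm]

lemma quadForm_eq_zero_iff (hm : 2 ≤ m) (h6 : ¬ 6 ∣ m) (l : Fin m → ℝ) :
    quadForm m l = 0 ↔ ∀ k ∈ Finset.Icc 1 (m - 1), ucoef m k l = 0 := by
  rw [quadForm, Finset.sum_eq_zero_iff_of_nonneg fun _ _ => by positivity]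
  refine forall₂_congr fun k hk => ?_
  have h : 2 * lam m k - 1 ≠ 0 := fun h => lam_ne_half h6 hk (by linarith)
  rw [← lcoef_eq_zero_iff (by omega)]
  simp [h]

lemma rSigmaA_mulVec_eq_zero_iff (hm : 2 ≤ m) (h6 : ¬ 6 ∣ m) (x : Fin m → ℝ) :
    (rSigmaA m).mulVec x = 0 ↔ x ∈ Submodule.span ℝ {(fun _ => 1 : Fin m → ℝ)} := by
  rw [← (rSigmaA_posSemidef m).dotProduct_mulVec_zero_iff, star_trivial,
    dotProduct_rSigmaA_mulVec, quadForm_eq_zero_iff hm h6, Submodule.mem_span_singleton]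
  constructor
  · intro h
    refine ⟨(m : ℝ)⁻¹ * ∑ i, x i, funext fun i => ?_⟩
    have h1 := sum_ucoef_mul_vvec x i
    rw [sum_range_eq_add_Icc (by omega), Finset.sum_eq_zero fun k hk => by rw [h k hk, zero_mul],
      add_zero, ucoef_zero, vvec_zero] at h1
    rw [← Complex.ofReal_inj, ← h1]
    simp [mul_comm]
  · rintro ⟨a, rfl⟩ k hk
    rw [Finset.mem_Icc] at hk
    have h1 := sum_cw_shift_eq_zero (m := m) (k := k) (by omega) (by omega)
    have h2 : cw m ^ k * ucoef m k (a • fun _ => 1) =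
        a * ∑ t : Fin m, cw m ^ (k * ((t : ℕ) + 1)) := by
      simp only [ucoef, Finset.mul_sum, Pi.smul_apply, smul_eq_mul, mul_one]
      exact Finset.sum_congr rfl fun t _ => by ring
    rw [h1, mul_zero] at h2
    exact (mul_eq_zero.1 h2).resolve_left (pow_ne_zero _ (cw_ne_zero m))

lemma rSigmaA_rank (hm : 2 ≤ m) (h6 : ¬ 6 ∣ m) : (rSigmaA m).rank = m - 1 := by
  have h1 := LinearMap.finrank_range_add_finrank_ker (rSigmaA m).mulVecLin
  have h2 : LinearMap.ker (rSigmaA m).mulVecLin = Submodule.span ℝ {(fun _ => 1 : Fin m → ℝ)} := by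
    ext x
    rw [LinearMap.mem_ker, Matrix.mulVecLin_apply, rSigmaA_mulVec_eq_zero_iff hm h6]
  have h3 : (fun _ => 1 : Fin m → ℝ) ≠ 0 := fun h =>
    one_ne_zero (congrFun h ⟨0, zero_lt_two.trans_le hm⟩)
  rw [h2, finrank_span_singleton h3, Module.finrank_fin_fun] at h1
  rw [Matrix.rank]
  omega

end Covariance

section GaussianLimit

variable {d : ℕ} {S : Matrix (Fin d) (Fin d) ℝ}

/-- The centred Gaussian distribution on `Fin d → ℝ`. -/
def gaussianPi (S : Matrix (Fin d) (Fin d) ℝ) : Measure (Fin d → ℝ) :=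
  (multivariateGaussian 0 S).map (WithLp.ofLp (p := 2))

instance isProbabilityMeasure_gaussianPi : IsProbabilityMeasure (gaussianPi S) :=
  Measure.isProbabilityMeasure_map (Measurable.aemeasurable (by fun_prop))

lemma inner_eq_sum_mul (x y : EuclideanSpace ℝ (Fin d)) : inner ℝ x y = ∑ i, y i * x i := by
  simp [PiLp.inner_apply]

lemma isCenteredGaussian_gaussianPi (hS : S.PosSemidef) :
    IsCenteredGaussian (gaussianPi S) S := by
  refine ⟨inferInstance, fun l => ?_⟩
  have hq : ∑ i, ∑ j, l i * S i j * l j = l ⬝ᵥ S.mulVec l := by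
    simp only [dotProduct, Matrix.mulVec, Finset.mul_sum, mul_assoc]
  have hq0 : 0 ≤ l ⬝ᵥ S.mulVec l := by simpa using hS.dotProduct_mulVec_nonneg l
  have : IsProbabilityMeasure ((gaussianPi S).map fun x => ∑ i, l i * x i) :=
    Measure.isProbabilityMeasure_map (Measurable.aemeasurable (by fun_prop))
  refine Measure.ext_of_charFun (funext fun s => ?_)
  rw [charFun_gaussianReal, hq, Real.coe_toNNReal _ hq0, charFun_apply_real, gaussianPi,
    Measure.map_map (by fun_prop) (by fun_prop), integral_map (by fun_prop) (by fun_prop)]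
  have h := charFun_multivariateGaussian (μ := 0) hS (WithLp.toLp 2 (s • l))
  rw [charFun_apply] at h
  convert h using 1
  · refine integral_congr_ae (ae_of_all _ fun x => ?_)
    simp only [Function.comp_apply, inner_eq_sum_mul]
    congr 2
    rw [← Complex.ofReal_mul, Finset.mul_sum]
    congr 1
    exact Finset.sum_congr rfl fun i _ => by simp [mul_assoc]
  · congr 1
    simp [Matrix.mulVec_smul, dotProduct_smul, smul_dotProduct]
    ring

lemma tendstoInDist_gaussianPi {Ω : Type*} [MeasurableSpace Ω] {μ : Measure Ω}
    [IsProbabilityMeasure μ] {X : ℕ → Ω → Fin d → ℝ} (hX : ∀ n, AEMeasurable (X n) μ)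
    (hS : S.PosSemidef)
    (h : ∀ l : Fin d → ℝ, Tendsto (fun n => ∫ ω, Complex.exp (((∑ i, l i * X n ω i : ℝ) : ℂ) *
      Complex.I) ∂μ) atTop (𝓝 ((Real.exp (-(l ⬝ᵥ S.mulVec l) / 2) : ℝ) : ℂ))) :
    TendstoInDist μ X (gaussianPi S) := by
  have hX' : ∀ n, AEMeasurable (fun ω => WithLp.toLp 2 (X n ω)) μ := fun n =>
    (WithLp.measurable_toLp 2 _).comp_aemeasurable (hX n)
  let P : ℕ → ProbabilityMeasure (EuclideanSpace ℝ (Fin d)) := fun n =>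
    ⟨μ.map fun ω => WithLp.toLp 2 (X n ω), Measure.isProbabilityMeasure_map (hX' n)⟩
  let Q : ProbabilityMeasure (EuclideanSpace ℝ (Fin d)) := ⟨multivariateGaussian 0 S, inferInstance⟩
  have hPQ : Tendsto P atTop (𝓝 Q) := by
    refine ProbabilityMeasure.tendsto_iff_tendsto_charFun.2 fun t => ?_
    have h1 : charFun (Q : Measure (EuclideanSpace ℝ (Fin d))) t =
        ((Real.exp (-(t.ofLp ⬝ᵥ S.mulVec t.ofLp) / 2) : ℝ) : ℂ) := by
      change charFun (multivariateGaussian 0 S) t = _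
      rw [charFun_multivariateGaussian hS]
      push_cast
      congr 1
      simp
      ring
    rw [h1]
    refine (h t).congr fun n => ?_
    change _ = charFun (μ.map fun ω => WithLp.toLp 2 (X n ω)) t
    rw [charFun_apply, integral_map (hX' n) (by fun_prop)]
    simp_rw [inner_eq_sum_mul]
  intro f
  have h2 := ProbabilityMeasure.tendsto_iff_forall_integral_tendsto.1 hPQ
    (f.compContinuous ⟨WithLp.ofLp (p := 2), by fun_prop⟩)
  convert h2 using 1
  · ext n
    change _ = ∫ x, f (WithLp.ofLp x) ∂(μ.map fun ω => WithLp.toLp 2 (X n ω))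
    rw [integral_map (hX' n)]
    exact (f.continuous.comp (by fun_prop)).aestronglyMeasurable
  · change 𝓝 _ = 𝓝 (∫ x, f (WithLp.ofLp x) ∂(multivariateGaussian 0 S))
    rw [gaussianPi, integral_map (by fun_prop) f.continuous.aestronglyMeasurable]

end GaussianLimit

theorem stmt0 {Ω : Type*} [MeasurableSpace Ω] (μ : Measure Ω) (m : ℕ) (hm : 2 ≤ m)
    (h6 : ¬ (6 ∣ m)) (R : ℕ → Ω → Fin m → ℝ)
    (hR : IsCyclicUrn μ m ⟨0, by omega⟩ R) :
    ∃ Ξ : ℕ → Ω → ℂ, ∃ ν : Measure (Fin m → ℝ),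
      (∀ i j, (cSigmaA m i j).im = 0) ∧
      (rSigmaA m).IsSymm ∧ (rSigmaA m).PosSemidef ∧ (rSigmaA m).rank = m - 1 ∧
      IsCenteredGaussian ν (rSigmaA m) ∧
      TendstoInDist μ
        (fun n ω i => (Real.sqrt n)⁻¹ *
          (R n ω i - expVec μ (R n) i -
            ∑ k ∈ Finset.Icc 1 ((m - 1) / 6),
              2 * ((n : ℂ) ^ (cw m ^ k) * Ξ k ω * vvec m k i).re)) ν := by
  have := hR.isProb
  obtain ⟨Ξ, hΞ, h⟩ := hR.exists_tendsto_charFun hm h6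
  refine ⟨Ξ, gaussianPi (rSigmaA m), cSigmaA_im, rSigmaA_isSymm m, rSigmaA_posSemidef m,
    rSigmaA_rank hm h6, isCenteredGaussian_gaussianPi (rSigmaA_posSemidef m),
    tendstoInDist_gaussianPi (fun n => ?_) (rSigmaA_posSemidef m) fun l => ?_⟩
  · refine aemeasurable_pi_lambda _ fun i => AEMeasurable.const_mul ?_ _
    refine ((hR.integrable_coord n i).aemeasurable.sub aemeasurable_const).sub ?_
    refine Finset.aemeasurable_fun_sum _ fun k _ => ?_
    have h1 := ((hΞ k).const_mul ((n : ℂ) ^ (cw m ^ k))).mul_const (vvec m k i)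
    exact (h1.re.const_mul 2).aemeasurable
  · rw [dotProduct_rSigmaA_mulVec]
    exact h l

end
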